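/- arXiv:1905.01225 — 2 statements merged into one kernel-verified Lean document; each statement's English description precedes it below -/
import Mathlib

section
/- Let $p$ be a prime with $p \equiv 3 \pmod 8$ or $p \equiv 5 \pmod 8$. Then the 2-class group of $L_p = \mathbb{Q}(\zeta_8, \sqrt{p})$ is trivial, i.e., the class number of $L_p$ is odd. -/
open NumberField

section Abstract

set_option linter.unusedSectionVars false

variable {A B : Type*} [CommRing A] [IsDomain A] [IsPrincipalIdealRing A]
  [CommRing B] [IsDedekindDomain B] [Algebra A B]

lemma principal_of_mul_span {J : Ideal B} {c k : B} (hc : c ≠ 0)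
    (h : J * Ideal.span {c} = Ideal.span {k}) : ∃ j, J = Ideal.span {j} := by
  have hk : c ∣ k := by
    rw [← Ideal.mem_span_singleton]
    apply Ideal.mul_le_left (I := Ideal.span {c}) (J := J)
    rw [mul_comm, h]; exact Ideal.mem_span_singleton_self k
  obtain ⟨j, hj⟩ := hk
  have h0 : Ideal.span {c} ≠ 0 := by
    rw [Ideal.zero_eq_bot, Ne, Ideal.span_singleton_eq_bot]; exact hc
  have h1 : J * Ideal.span {c} = Ideal.span {j} * Ideal.span {c} := by
    rw [h, Ideal.span_singleton_mul_span_singleton, hj, mul_comm]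
  exact ⟨j, mul_right_cancel₀ h0 h1⟩

lemma stable_ideal (σ : B ≃+* B) (hσ : ∀ x, σ (σ x) = x)
    (hfix : ∀ x, σ x = x → ∃ a : A, algebraMap A B a = x)
    (θ : B) (J : Ideal B) (hJ : J ≠ ⊥)
    (hst : ∀ x ∈ J, σ x ∈ J) :
    ∃ (k : A) (C : Ideal B), C ∣ Ideal.span {θ - σ θ} ∧
      J * C = Ideal.span {algebraMap A B k} := by
  obtain ⟨k, hk⟩ := (IsPrincipalIdealRing.principal (J.comap (algebraMap A B))).principal
  have hk' : J.comap (algebraMap A B) = Ideal.span {k} := hk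
  have hkJ : algebraMap A B k ∈ J := by
    have : k ∈ J.comap (algebraMap A B) := hk' ▸ Ideal.mem_span_singleton_self k
    exact this
  have hle : Ideal.span {algebraMap A B k} ≤ J := by
    rw [Ideal.span_singleton_le_iff_mem]; exact hkJ
  obtain ⟨C, hC⟩ := Ideal.dvd_iff_le.2 hle
  refine ⟨k, C, ?_, hC.symm⟩
  have key : ∀ x ∈ J, σ x = x → x ∈ Ideal.span {algebraMap A B k} := by
    intro x hx hxs
    obtain ⟨a, rfl⟩ := hfix x hxs
    have : a ∈ J.comap (algebraMap A B) := hx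
    rw [hk', Ideal.mem_span_singleton] at this
    rw [Ideal.mem_span_singleton]
    exact map_dvd _ this
  have h2 : J * Ideal.span {θ - σ θ} ≤ J * C := by
    rw [← hC, Ideal.mul_le]
    intro x hx y hy
    obtain ⟨b, rfl⟩ := Ideal.mem_span_singleton'.1 hy
    have e : x * (b * (θ - σ θ)) = b * ((x * θ + σ (x * θ)) - σ θ * (x + σ x)) := by
      simp only [map_mul]; ring
    rw [e]
    refine Ideal.mul_mem_left _ _ (Ideal.sub_mem _ (key _ ?_ ?_) (Ideal.mul_mem_left _ _ (key _ ?_ ?_)))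
    · exact J.add_mem (J.mul_mem_right _ hx) (by rw [map_mul]; exact J.mul_mem_right _ (hst _ hx))
    · rw [map_add, hσ, add_comm]
    · exact J.add_mem hx (hst _ hx)
    · rw [map_add, hσ, add_comm]
  have h3 := Ideal.dvd_iff_le.2 h2
  exact (mul_dvd_mul_iff_left (by simpa [Ideal.zero_eq_bot] using hJ)).1 h3

lemma hilbert_div (σ : B ≃+* B) (hσ : ∀ x, σ (σ x) = x)
    (hfix : ∀ x, σ x = x ↔ ∃ a : A, algebraMap A B a = x)
    (θ : B) (hθ : θ - σ θ ≠ 0) (x : Bˣ) (hx : (x : B) * σ x = 1) :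
    ∃ γ : B, γ ≠ 0 ∧ Ideal.span {γ} ∣ Ideal.span {θ - σ θ} ∧ σ γ = x * γ := by
  obtain ⟨β, hβ0, hβ⟩ : ∃ β : B, β ≠ 0 ∧ x * σ β = β := by
    by_cases h : (1 : B) + x = 0
    · refine ⟨θ - σ θ, hθ, ?_⟩
      have : (x : B) = -1 := by linear_combination h
      rw [this, map_sub, hσ]; ring
    · exact ⟨1 + x, h, by rw [map_add, map_one]; linear_combination hx⟩
  have hs0 : σ β ≠ 0 := by simpa using hβ0
  have hσβ : σ β = σ x * β := by
    have := congrArg σ hβ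
    rw [map_mul, hσ] at this; exact this.symm
  obtain ⟨k, C, hC, hk⟩ := stable_ideal (A := A) σ hσ (fun x h => (hfix x).1 h) θ (Ideal.span {β})
    (by simpa using hβ0) (by
      intro y hy
      obtain ⟨b, rfl⟩ := Ideal.mem_span_singleton'.1 hy
      rw [map_mul, hσβ, ← mul_assoc]
      exact Ideal.mul_mem_left _ _ (Ideal.mem_span_singleton_self β))
  rw [mul_comm] at hk
  have hδ0 : Ideal.span {θ - σ θ} ≠ 0 := by simpa [Ideal.zero_eq_bot] using hθ
  obtain ⟨γ, rfl⟩ := principal_of_mul_span hβ0 hk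
  have hγ0 : γ ≠ 0 := by
    rintro rfl
    apply hδ0
    have : (0 : Ideal B) ∣ Ideal.span {θ - σ θ} := by simpa using hC
    exact zero_dvd_iff.1 this
  rw [Ideal.span_singleton_mul_span_singleton, Ideal.span_singleton_eq_span_singleton] at hk
  obtain ⟨u, hu⟩ := hk
  have hγu : γ * u ≠ 0 := mul_ne_zero hγ0 u.ne_zero
  refine ⟨γ * u, hγu, ?_, ?_⟩
  · rwa [Ideal.span_singleton_mul_right_unit u.isUnit]
  · have hf : σ (γ * u * β) = γ * u * β := (hfix _).2 ⟨k, by rw [← hu]; ring⟩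
    rw [map_mul] at hf
    apply mul_right_cancel₀ hs0
    rw [hf]
    linear_combination (- γ * u) * hβ

/-- the automorphism on units -/
abbrev uσ (σ : B ≃+* B) : Bˣ →* Bˣ := Units.map (σ : B →* B)
/-- the norm on units -/
def uN (σ : B ≃+* B) : Bˣ →* Bˣ := MonoidHom.id _ * uσ σ
/-- the map `x ↦ x / σ x` on units -/
def uD (σ : B ≃+* B) : Bˣ →* Bˣ := MonoidHom.id _ / uσ σ
/-- fixed units -/
def uF (σ : B ≃+* B) : Subgroup Bˣ := (uD σ).ker
/-- squares of a subgroup -/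
abbrev sqs (H : Subgroup Bˣ) : Subgroup Bˣ := H.map (powMonoidHom 2)

lemma mem_uN_ker (σ : B ≃+* B) (x : Bˣ) : x ∈ (uN σ).ker ↔ (x : B) * σ x = 1 := by
  rw [MonoidHom.mem_ker, Units.ext_iff]; simp [uN]
lemma mem_uF (σ : B ≃+* B) (x : Bˣ) : x ∈ uF σ ↔ σ x = (x : B) := by
  rw [uF, MonoidHom.mem_ker, uD, MonoidHom.div_apply, div_eq_one, Units.ext_iff]; simp [eq_comm]

/-- fixed units that are norms of elements of the fraction field -/
def uS (σ : B ≃+* B) : Subgroup Bˣ where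
  carrier := {x | σ x = (x : B) ∧ ∃ a c : B, c ≠ 0 ∧ (x : B) * (c * σ c) = a * σ a}
  one_mem' := ⟨by simp, 1, 1, by simp, by simp⟩
  mul_mem' := by
    rintro x y ⟨hx, a, c, hc, h⟩ ⟨hy, a', c', hc', h'⟩
    refine ⟨by simp [hx, hy], a * a', c * c', mul_ne_zero hc hc', ?_⟩
    simp only [Units.val_mul, map_mul]
    linear_combination (y * (c' * σ c')) * h + a * σ a * h'
  inv_mem' := by
    rintro x ⟨hx, a, c, hc, h⟩
    have hx' : (x⁻¹ : Bˣ) ∈ uF σ := inv_mem ((mem_uF σ x).2 hx)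
    refine ⟨(mem_uF σ _).1 hx', c, a, ?_, ?_⟩
    · rintro rfl
      have := x.ne_zero
      simp_all
    · rw [← h, ← mul_assoc, Units.inv_mul, one_mul]

lemma unit_count (σ : B ≃+* B) (hσ : ∀ x, σ (σ x) = x)
    (hfix : ∀ x, σ x = x ↔ ∃ a : A, algebraMap A B a = x)
    (θ : B) (hθ : θ - σ θ ≠ 0)
    (hF0 : (sqs (uF σ)).relIndex (uF σ) ≠ 0) (hF : (sqs (uF σ)).relIndex (uF σ) ≤ 4)
    (hH : 8 ≤ (sqs (uN σ).ker).relIndex (uN σ).ker)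
    (hfin : {C : Ideal B | C ∣ Ideal.span {θ - σ θ}}.Finite)
    (hdiv : {C : Ideal B | C ∣ Ideal.span {θ - σ θ}}.ncard ≤ 4)
    (z : Bˣ) (hzF : σ z = (z : B))
    (hz : ∀ a c : B, (z : B) * (c * σ c) = a * σ a → c = 0) :
    (∀ C : Ideal B, C ∣ Ideal.span {θ - σ θ} → ∃ c, C = Ideal.span {c}) ∧
      uS σ ≤ (uN σ).range := by
  have hσ' : ∀ x, uσ σ (uσ σ x) = x := fun x => by ext; simp [hσ]
  have hNF : (uN σ).range ≤ uF σ := by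
    rintro _ ⟨x, rfl⟩
    rw [mem_uF]; simp [uN, hσ, mul_comm]
  have hNS : (uN σ).range ≤ uS σ := by
    rintro _ ⟨x, rfl⟩
    exact ⟨(mem_uF σ _).1 (hNF ⟨x, rfl⟩), x, 1, one_ne_zero, by simp [uN]⟩
  have hSF : uS σ ≤ uF σ := fun x hx => (mem_uF σ x).2 hx.1
  have hsN : sqs (uF σ) ≤ (uN σ).range := by
    rintro _ ⟨x, hx, rfl⟩
    refine ⟨x, ?_⟩
    have := (mem_uF σ x).1 hx
    ext; simp [uN, this, sq]
  have hDH : (uD σ).range ≤ (uN σ).ker := by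
    rintro _ ⟨x, rfl⟩
    rw [MonoidHom.mem_ker]
    change x / uσ σ x * uσ σ (x / uσ σ x) = 1
    rw [map_div, hσ', div_mul_div_cancel, div_self']
  have hHs : ∀ x ∈ (uN σ).ker, uσ σ x = x⁻¹ := by
    intro x hx
    rw [MonoidHom.mem_ker] at hx
    simp only [uN, MonoidHom.mul_apply, MonoidHom.id_apply] at hx
    exact (inv_eq_of_mul_eq_one_right hx).symm
  have hFs : ∀ x ∈ uF σ, uσ σ x = x := by
    intro x hx
    ext; simpa using (mem_uF σ x).1 hx
  have hFs' : ∀ x, uσ σ x = x → x ∈ uF σ := by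
    intro x hx
    rw [mem_uF]; simpa using congrArg Units.val hx
  have hHD : sqs (uN σ).ker ≤ (uD σ).range := by
    rintro _ ⟨x, hx, rfl⟩
    refine ⟨x, ?_⟩
    simp [uD, hHs x hx, sq]
  -- both comaps coincide
  have hcomap : (sqs (uN σ).ker).comap (uD σ) = (sqs (uF σ)).comap (uN σ) := by
    ext x
    simp only [Subgroup.mem_comap, Subgroup.mem_map, powMonoidHom_apply, uD, uN,
      MonoidHom.mul_apply, MonoidHom.div_apply, MonoidHom.id_apply]
    constructor
    · rintro ⟨h, hh, e⟩
      refine ⟨x * h⁻¹, hFs' _ ?_, ?_⟩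
      · have := hHs h hh
        rw [map_mul, map_inv, this, inv_inv]
        rw [eq_mul_inv_iff_mul_eq, mul_assoc, ← sq, e, mul_div_cancel]
      · have e2 : uσ σ x = x * (h ^ 2)⁻¹ := by rw [e]; simp
        rw [e2, mul_pow, inv_pow, sq x, mul_assoc]
    · rintro ⟨h, hh, e⟩
      have e2 : uσ σ x = x⁻¹ * h ^ 2 := by rw [e]; simp
      refine ⟨x * h⁻¹, ?_, ?_⟩
      · rw [MonoidHom.mem_ker]
        change x * h⁻¹ * uσ σ (x * h⁻¹) = 1
        rw [map_mul, map_inv, hFs h hh, e2, mul_comm x h⁻¹]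
        simp [sq, mul_assoc]
      · rw [e2, mul_pow, inv_pow, sq x, div_eq_mul_inv, mul_inv_rev, inv_inv]
        rw [mul_assoc, mul_comm (h ^ 2)⁻¹ x]
  have hidx : (sqs (uN σ).ker).relIndex (uD σ).range = (sqs (uF σ)).relIndex (uN σ).range := by
    rw [← Subgroup.index_comap, ← Subgroup.index_comap, hcomap]
  have hzS : z ∉ uS σ := fun h => by
    obtain ⟨-, a, c, hc, e⟩ := h
    exact hc (hz a c e)
  have hzF' : z ∈ uF σ := (mem_uF σ z).2 hzF
  have e1 := Subgroup.relIndex_mul_relIndex _ _ _ (hsN.trans hNS) hSF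
  have e2 := Subgroup.relIndex_mul_relIndex _ _ _ hsN hNS
  have e3 := Subgroup.relIndex_mul_relIndex _ _ _ hHD hDH
  rw [hidx] at e3
  have hSne : (uS σ).relIndex (uF σ) ≠ 1 := fun h => hzS (Subgroup.relIndex_eq_one.1 h hzF')
  set s1 := (sqs (uF σ)).relIndex (uS σ)
  set s2 := (uS σ).relIndex (uF σ)
  set n1 := (sqs (uF σ)).relIndex (uN σ).range
  set n2 := (uN σ).range.relIndex (uS σ)
  set d := (uD σ).range.relIndex (uN σ).ker with hd
  have hs2 : 2 ≤ s2 := by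
    rcases Nat.lt_or_ge s2 2 with h | h
    · interval_cases s2
      · exact absurd (e1.symm.trans (mul_zero _)) hF0
      · exact absurd rfl hSne
    · exact h
  have hs1 : s1 ≤ 2 := by nlinarith
  have hs10 : s1 ≠ 0 := by rintro h; rw [h, zero_mul] at e1; exact hF0 e1.symm
  have hn1 : n1 ≤ 2 := by
    have : n2 ≠ 0 := by rintro h; rw [h, mul_zero] at e2; exact hs10 e2.symm
    have : 1 ≤ n2 := Nat.one_le_iff_ne_zero.2 this
    nlinarith
  -- the map to divisors
  have hex : ∀ x : (uN σ).ker, ∃ γ : B, γ ≠ 0 ∧ Ideal.span {γ} ∣ Ideal.span {θ - σ θ} ∧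
      σ γ = (x : Bˣ) * γ := fun x =>
    hilbert_div (A := A) σ hσ hfix θ hθ x ((mem_uN_ker σ x).1 x.2)
  choose g hg0 hgd hgs using hex
  set T : Set (Ideal B) := {C : Ideal B | C ∣ Ideal.span {θ - σ θ}} with hT
  set T' : Set (Ideal B) := {C : Ideal B | C ∣ Ideal.span {θ - σ θ} ∧ ∃ c, C = Ideal.span {c}}
  have hTT : T' ⊆ T := fun C h => h.1
  have hT'fin : T'.Finite := hfin.subset hTT
  have hdT : d ≤ T'.ncard := by
    rw [hd, Subgroup.relIndex, Subgroup.index, ← Nat.card_coe_set_eq]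
    have : Finite T' := hT'fin
    refine Nat.card_le_card_of_injective
      (fun q => (⟨Ideal.span {g q.out}, hgd _, _, rfl⟩ : T')) ?_
    intro q r hqr
    have h1 : Ideal.span {g q.out} = Ideal.span {g r.out} := congrArg Subtype.val hqr
    rw [Ideal.span_singleton_eq_span_singleton] at h1
    obtain ⟨w, hw⟩ := h1
    rw [← q.out_eq', ← r.out_eq', QuotientGroup.eq, Subgroup.mem_subgroupOf]
    refine ⟨w⁻¹, ?_⟩
    have h2 := hgs r.out
    rw [← hw, map_mul, hgs q.out] at h2
    have h3 : (((q.out : (uN σ).ker) : Bˣ) : B) * σ w = (((r.out : (uN σ).ker) : Bˣ) : B) * w := by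
      apply mul_left_cancel₀ (hg0 q.out)
      linear_combination h2
    have h4 : ((q.out : (uN σ).ker) : Bˣ) * uσ σ w = ((r.out : (uN σ).ker) : Bˣ) * w := by
      ext; simpa using h3
    simp only [uD, MonoidHom.div_apply, MonoidHom.id_apply, map_inv, Subgroup.coe_mul,
      Subgroup.coe_inv]
    rw [inv_div, eq_inv_mul_iff_mul_eq, ← mul_div_assoc, h4, mul_div_cancel_right]
  have hd4 : 4 ≤ d := by nlinarith
  have hTeq : T' = T := Set.eq_of_subset_of_ncard_le hTT (by omega) hfin
  refine ⟨fun C hC => ?_, ?_⟩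
  · have : C ∈ T' := hTeq ▸ hC
    exact this.2
  · have hd5 : d = 4 := by
      have := Set.ncard_le_ncard hTT hfin
      omega
    rw [hd5] at e3
    have : n1 = 2 := by omega
    rw [this] at e2
    have : n2 ≠ 0 := by rintro h; rw [h, mul_zero] at e2; exact hs10 e2.symm
    exact Subgroup.relIndex_eq_one.1 (show n2 = 1 by omega)

lemma stable_principal (σ : B ≃+* B) (hσ : ∀ x, σ (σ x) = x)
    (hfix : ∀ x, σ x = x ↔ ∃ a : A, algebraMap A B a = x)
    (θ : B) (hθ : θ - σ θ ≠ 0)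
    (hP : ∀ C : Ideal B, C ∣ Ideal.span {θ - σ θ} → ∃ c, C = Ideal.span {c})
    (J : Ideal B) (hJ : J ≠ ⊥) (hst : J.map (σ : B →+* B) ≤ J) : ∃ j, J = Ideal.span {j} := by
  obtain ⟨k, C, hC, hk⟩ := stable_ideal (A := A) σ hσ (fun x h => (hfix x).1 h) θ J hJ
    (fun x hx => hst (Ideal.mem_map_of_mem _ hx))
  have hδ0 : Ideal.span {θ - σ θ} ≠ 0 := by simpa [Ideal.zero_eq_bot] using hθ
  obtain ⟨c, hc⟩ := hP C hC
  rw [hc] at hk hC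
  refine principal_of_mul_span ?_ hk
  rintro rfl
  apply hδ0
  have : (0 : Ideal B) ∣ Ideal.span {θ - σ θ} := by simpa using hC
  exact zero_dvd_iff.1 this

lemma principal_of_sq (σ : B ≃+* B) (hσ : ∀ x, σ (σ x) = x)
    (hfix : ∀ x, σ x = x ↔ ∃ a : A, algebraMap A B a = x)
    (θ : B) (hθ : θ - σ θ ≠ 0)
    (hP : ∀ C : Ideal B, C ∣ Ideal.span {θ - σ θ} → ∃ c, C = Ideal.span {c})
    (hS : uS σ ≤ (uN σ).range)
    (I : Ideal B) (hI : I ≠ ⊥) (m : B) (hm : I * I = Ideal.span {m}) :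
    ∃ j, I = Ideal.span {j} := by
  set f : B →+* B := (σ : B →+* B) with hf
  have hfa : ∀ x, f x = σ x := fun x => rfl
  have hff : ∀ J : Ideal B, (J.map f).map f = J := by
    intro J
    rw [Ideal.map_map]
    have : f.comp f = RingHom.id B := by ext x; exact hσ x
    rw [this, Ideal.map_id]
  have hsp : ∀ x, (Ideal.span {x}).map f = Ideal.span {σ x} := by
    intro x; rw [Ideal.map_span, Set.image_singleton, hfa]
  have hI0 : I ≠ 0 := hI
  have hσI0 : I.map f ≠ 0 := by
    intro h
    apply hI0
    rw [← hff I, h, Ideal.zero_eq_bot, Ideal.map_bot]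
  obtain ⟨n, hn⟩ := stable_principal (A := A) σ hσ hfix θ hθ hP (I * I.map f)
    (mul_ne_zero hI0 hσI0) (by
      change Ideal.map f _ ≤ _
      rw [Ideal.map_mul, hff, mul_comm])
  have hm0 : m ≠ 0 := by
    rintro rfl
    refine mul_ne_zero hI0 hI0 ?_
    rw [hm]; simp
  have hms0 : Ideal.span {m} ≠ 0 := by simpa using hm0
  have r1 : I.map f * Ideal.span {m} = I * Ideal.span {n} := by
    rw [← hm, ← hn]; ac_rfl
  have r2 : I * Ideal.span {σ m} = I.map f * Ideal.span {σ n} := by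
    have := congrArg (Ideal.map f) r1
    rwa [Ideal.map_mul, Ideal.map_mul, hff, hsp, hsp] at this
  have r3 : Ideal.span {m * σ m} = Ideal.span {n * σ n} := by
    apply mul_left_cancel₀ hI0
    rw [← Ideal.span_singleton_mul_span_singleton, ← Ideal.span_singleton_mul_span_singleton,
      ← mul_assoc, ← mul_assoc, ← r1, mul_right_comm, r2]
    ac_rfl
  rw [Ideal.span_singleton_eq_span_singleton] at r3
  obtain ⟨u, hu⟩ := r3
  have hsm0 : σ m ≠ 0 := by simpa using hm0
  have huf : σ u = (u : B) := by
    have h := congrArg σ hu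
    simp only [map_mul, hσ] at h
    apply mul_left_cancel₀ (mul_ne_zero hm0 hsm0)
    linear_combination h - hu
  obtain ⟨w, hw⟩ := hS (show u ∈ uS σ from ⟨huf, n, m, hm0, by linear_combination hu⟩)
  have hw' : (w : B) * σ w = u := by
    rw [← hw]; simp [uN]
  have hmw : m * (w : B) ≠ 0 := mul_ne_zero hm0 w.ne_zero
  obtain ⟨y, hy⟩ : ∃ y : B, m * w * y + n * σ y ≠ 0 := by
    by_cases h : m * (w : B) + n = 0
    · refine ⟨θ, ?_⟩
      have : n = - (m * w) := by linear_combination h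
      rw [this]
      have := mul_ne_zero hmw hθ
      intro h'
      apply this
      linear_combination h'
    · exact ⟨1, by simpa using h⟩
  set β : B := σ (m * w) * (m * w * y + n * σ y) with hβ
  have hβ0 : β ≠ 0 := mul_ne_zero (by simpa using hmw) hy
  have hβs : σ β * n = m * w * β := by
    rw [hβ]
    simp only [map_mul, map_add, hσ]
    linear_combination (-(m * w * y)) * hu + (-(m * w * y) * m * σ m) * (hw')
  have hβs0 : Ideal.span {β} ≠ 0 := by simpa using hβ0
  obtain ⟨j, hj⟩ := stable_principal (A := A) σ hσ hfix θ hθ hP (I * Ideal.span {β})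
    (mul_ne_zero hI0 hβs0) (by
      change Ideal.map f _ ≤ _
      apply le_of_eq
      apply mul_right_cancel₀ hms0
      rw [Ideal.map_mul, hsp, mul_right_comm, r1, mul_assoc,
        Ideal.span_singleton_mul_span_singleton, mul_assoc I,
        Ideal.span_singleton_mul_span_singleton, mul_comm n, hβs]
      congr 1
      rw [Ideal.span_singleton_eq_span_singleton]
      refine ⟨w⁻¹, ?_⟩
      calc m * (w : B) * β * ((w⁻¹ : Bˣ) : B) = m * β * ((w : B) * ((w⁻¹ : Bˣ) : B)) := by ring
        _ = β * m := by rw [Units.mul_inv]; ring)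
  exact principal_of_mul_span hβ0 hj

end Abstract

section Cyc8

lemma eight_pid (K : Type*) [Field K] [NumberField K] [h8 : IsCyclotomicExtension {8} ℚ K] :
    IsPrincipalIdealRing (𝓞 K) := by
  haveI h8' : IsCyclotomicExtension {2 ^ (1 + 2)} ℚ K := by norm_num; exact h8
  have hζ : IsPrimitiveRoot (IsCyclotomicExtension.zeta 8 ℚ K) (2 ^ (1 + 2)) :=
    IsCyclotomicExtension.zeta_spec 8 ℚ K
  have hnorm := hζ.norm_toInteger_sub_one_of_eq_two_pow
  set z := hζ.toInteger
  have hz8 : z ^ 8 = 1 := by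
    have := hζ.toInteger_isPrimitiveRoot.pow_eq_one
    simpa using this
  have hdisc : (NumberField.discr K) = 256 := by
    haveI : Fact (Nat.Prime 2) := ⟨Nat.prime_two⟩
    have := IsCyclotomicExtension.Rat.discr_prime_pow_succ 2 (k := 2) K
    rw [this]; norm_num
  have hfin : Module.finrank ℚ K = 4 := by
    rw [IsCyclotomicExtension.Rat.finrank 8 K]; decide
  have hcp : InfinitePlace.nrComplexPlaces K = 2 := by
    have h1 := IsCyclotomicExtension.Rat.nrRealPlaces_eq_zero (n := 8) K (by norm_num)
    have h2 := InfinitePlace.card_add_two_mul_card_eq_rank K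
    omega
  apply RingOfIntegers.isPrincipalIdealRing_of_isPrincipal_of_norm_le
  intro I hI
  have hI3 : Ideal.absNorm (I : Ideal (𝓞 K)) < 3 := by
    have : ((Ideal.absNorm (I : Ideal (𝓞 K)) : ℕ) : ℝ) < 3 := by
      refine lt_of_le_of_lt hI ?_
      rw [hdisc, hfin, hcp]
      have hs : √|((256 : ℤ) : ℝ)| = 16 := by
        rw [show |((256 : ℤ) : ℝ)| = 16 ^ 2 by norm_num]
        exact Real.sqrt_sq (by norm_num)
      rw [hs]
      have hpi := Real.pi_gt_three
      have : (4 / Real.pi) ^ 2 < 16 / 9 := by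
        rw [div_pow, div_lt_div_iff₀ (by positivity) (by norm_num)]
        nlinarith
      norm_num [Nat.factorial]
      norm_num at this
      linarith
    exact_mod_cast this
  have hI0 : Ideal.absNorm (I : Ideal (𝓞 K)) ≠ 0 := Ideal.absNorm_ne_zero_of_nonZeroDivisors I
  obtain ⟨I, hIz⟩ := I
  simp only at hI3 hI0 ⊢
  rcases (by omega : Ideal.absNorm I = 1 ∨ Ideal.absNorm I = 2) with h | h
  · rw [Ideal.absNorm_eq_one_iff] at h
    rw [h]; exact top_isPrincipal
  · have hmem : z - 1 ∈ I := by
      rw [← Ideal.Quotient.eq_zero_iff_mem, map_sub, map_one, sub_eq_zero]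
      have hc : Nat.card (𝓞 K ⧸ I) = 2 := h
      have hne : I ≠ ⊤ := by
        rintro rfl
        rw [Ideal.absNorm_top] at h; omega
      haveI : Nontrivial (𝓞 K ⧸ I) := Ideal.Quotient.nontrivial_iff.2 hne
      have hz0 : Ideal.Quotient.mk I z ≠ 0 := by
        intro h0
        have := congrArg (Ideal.Quotient.mk I) hz8
        rw [map_pow, h0, map_one] at this
        norm_num at this
      obtain ⟨a, b, hab, huniv⟩ := Nat.card_eq_two_iff.1 hc
      have key : ∀ x : 𝓞 K ⧸ I, x = a ∨ x = b := fun x => by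
        have : x ∈ ({a, b} : Set _) := huniv ▸ Set.mem_univ x
        simpa using this
      have h10 : (1 : 𝓞 K ⧸ I) ≠ 0 := one_ne_zero
      rcases key 0 with h | h <;> rcases key 1 with h' | h' <;>
        rcases key (Ideal.Quotient.mk I z) with h'' | h'' <;> simp_all
    have hle : Ideal.span {z - 1} ≤ I := by rwa [Ideal.span_singleton_le_iff_mem]
    obtain ⟨J, hJ⟩ := Ideal.dvd_iff_le.2 hle
    have hn : Ideal.absNorm (Ideal.span {z - 1}) = 2 := by
      rw [Ideal.absNorm_span_singleton, hnorm]; rfl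
    rw [hJ, map_mul, h] at hn
    have hJ1 : Ideal.absNorm J = 1 := by omega
    rw [Ideal.absNorm_eq_one_iff] at hJ1
    rw [hJ1, Ideal.mul_top] at hJ
    rw [← hJ]
    exact ⟨⟨z - 1, rfl⟩⟩

variable {K : Type*} [Field K] [NumberField K] [h8 : IsCyclotomicExtension {8} ℚ K]

lemma natCast_not_isUnit (K : Type*) [Field K] [NumberField K] {p : ℕ} (hp : p.Prime) :
    ¬ IsUnit (p : 𝓞 K) := by
  intro h
  have h1 := h.map (Algebra.norm ℤ)
  have h2 : Algebra.norm ℤ (p : 𝓞 K) = (p : ℤ) ^ Module.finrank ℤ (𝓞 K) := by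
    have := Algebra.norm_algebraMap_of_basis (RingOfIntegers.basis K) (p : ℤ)
    rw [Module.finrank_eq_card_basis (RingOfIntegers.basis K), ← this]
    simp
  rw [h2] at h1
  have h3 : IsUnit (p : ℤ) := (isUnit_pow_iff (Module.finrank_pos).ne').1 h1
  rw [Int.isUnit_iff_natAbs_eq] at h3
  simp at h3
  exact hp.one_lt.ne' h3

lemma frob_dvd {ζ : K} (hζ : IsPrimitiveRoot ζ 8) {p : ℕ} (hp : p.Prime) (h : p ^ 2 % 8 = 1)
    (x : 𝓞 K) : (p : 𝓞 K) ∣ x ^ (p ^ 2) - x := by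
  haveI : Fact p.Prime := ⟨hp⟩
  have htop : Algebra.adjoin ℤ {hζ.toInteger} = ⊤ := by
    have := hζ.integralPowerBasis.adjoin_gen_eq_top
    rwa [hζ.integralPowerBasis_gen] at this
  have hx : x ∈ Algebra.adjoin ℤ {hζ.toInteger} := htop ▸ Algebra.mem_top
  induction hx using Algebra.adjoin_induction with
  | mem x hx =>
    rw [Set.mem_singleton_iff] at hx
    subst hx
    have h8 : hζ.toInteger ^ 8 = 1 := hζ.toInteger_isPrimitiveRoot.pow_eq_one
    have : hζ.toInteger ^ (p ^ 2) = hζ.toInteger := by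
      rw [← Nat.div_add_mod (p ^ 2) 8, h, pow_add, pow_mul, h8, one_pow, one_mul, pow_one]
    rw [this, sub_self]; exact dvd_zero _
  | algebraMap r =>
    have : (p : ℤ) ∣ r ^ (p ^ 2) - r := by
      rw [← ZMod.intCast_zmod_eq_zero_iff_dvd]
      push_cast
      rw [ZMod.pow_card_pow, sub_self]
    have := map_dvd (algebraMap ℤ (𝓞 K)) this
    simpa using this
  | add x y _ _ hx hy =>
    obtain ⟨r, hr⟩ := exists_add_pow_prime_pow_eq hp x y 2
    rw [hr]
    obtain ⟨a, ha⟩ := hx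
    obtain ⟨b, hb⟩ := hy
    exact ⟨a + b + x * y * r, by linear_combination ha + hb⟩
  | mul x y _ _ hx hy =>
    obtain ⟨a, ha⟩ := hx
    obtain ⟨b, hb⟩ := hy
    exact ⟨a * y ^ (p ^ 2) + x * b, by rw [mul_pow]; linear_combination y ^ (p ^ 2) * ha + x * hb⟩

lemma dvd_of_dvd_sq {ζ : K} (hζ : IsPrimitiveRoot ζ 8) {p : ℕ} (hp : p.Prime) (h : p ^ 2 % 8 = 1)
    (x : 𝓞 K) (hx : (p : 𝓞 K) ∣ x ^ 2) : (p : 𝓞 K) ∣ x := by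
  have h1 := frob_dvd hζ hp h x
  have h2 : (p : 𝓞 K) ∣ x ^ (p ^ 2) :=
    hx.trans (pow_dvd_pow _ (by nlinarith [hp.two_le]))
  have := dvd_sub h2 h1
  simpa using this

lemma dvd_c {ζ : K} (hζ : IsPrimitiveRoot ζ 8) {p : ℕ} (hp : p.Prime) (h : p ^ 2 % 16 = 9)
    (a c : 𝓞 K) (hac : (p : 𝓞 K) ∣ a ^ 2 - hζ.toInteger * c ^ 2) : (p : 𝓞 K) ∣ c := by
  have h' : p ^ 2 % 8 = 1 := by omega
  obtain ⟨e, he⟩ : ∃ e, p ^ 2 = 2 * (8 * e + 4) + 1 := ⟨p ^ 2 / 16, by omega⟩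
  have hz4 : hζ.toInteger ^ 4 = -1 := by
    have h8 : hζ.toInteger ^ 8 = 1 := hζ.toInteger_isPrimitiveRoot.pow_eq_one
    have h4 : hζ.toInteger ^ 4 ≠ 1 :=
      hζ.toInteger_isPrimitiveRoot.pow_ne_one_of_pos_of_lt (by norm_num) (by norm_num)
    have : (hζ.toInteger ^ 4 - 1) * (hζ.toInteger ^ 4 + 1) = 0 := by linear_combination h8
    rcases mul_eq_zero.1 this with h | h
    · exact absurd (sub_eq_zero.1 h) h4
    · linear_combination h
  have hz8 : hζ.toInteger ^ 8 = 1 := hζ.toInteger_isPrimitiveRoot.pow_eq_one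
  have hze : hζ.toInteger ^ (8 * e + 4) = -1 := by
    rw [pow_add, pow_mul, hz8, one_pow, one_mul, hz4]
  have h1 := hac.trans (sub_dvd_pow_sub_pow (a ^ 2) (hζ.toInteger * c ^ 2) (8 * e + 4))
  rw [mul_pow, hze, ← pow_mul, ← pow_mul] at h1
  have ha := frob_dvd hζ hp h' a
  have hc := frob_dvd hζ hp h' c
  rw [he, pow_succ] at ha hc
  obtain ⟨m, hm⟩ : ∃ m, 2 * (8 * e + 4) = m + 1 := ⟨16 * e + 7, by ring⟩
  set G := a ^ (2 * (8 * e + 4)) with hG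
  set E := c ^ (2 * (8 * e + 4)) with hE
  have hGG : (p : 𝓞 K) ∣ G * G - G := by
    have : G * G - G = (G * a - a) * a ^ m := by
      have : G = a * a ^ m := by rw [hG, hm, pow_succ']
      linear_combination (G - 1) * this
    rw [this]; exact ha.mul_right _
  have hEE : (p : 𝓞 K) ∣ E * E - E := by
    have : E * E - E = (E * c - c) * c ^ m := by
      have : E = c * c ^ m := by rw [hE, hm, pow_succ']
      linear_combination (E - 1) * this
    rw [this]; exact hc.mul_right _
  -- 2 * E is divisible by p
  obtain ⟨r1, k1⟩ := h1
  obtain ⟨r2, k2⟩ := hGG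
  obtain ⟨r3, k3⟩ := hEE
  obtain ⟨r4, k4⟩ := hc
  obtain ⟨l, hl⟩ : ∃ l, p = 2 * l + 1 := by
    have : p % 2 = 1 := by
      rcases Nat.mod_two_eq_zero_or_one p with h0 | h0
      · exfalso
        obtain ⟨t, ht⟩ := Nat.dvd_of_mod_eq_zero h0
        rw [ht, mul_pow] at h; omega
      · exact h0
    exact ⟨p / 2, by omega⟩
  have hpl : (p : 𝓞 K) = 2 * l + 1 := by exact_mod_cast congrArg (Nat.cast : ℕ → 𝓞 K) hl
  -- G = -E + p r1, G^2 = G + p r2, E^2 = E + p r3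
  have k5 : 2 * E = (p : 𝓞 K) * (r1 + r2 - r3 - r1 * (G - E)) := by
    linear_combination (1 - (G - E)) * k1 + k2 - k3
  have k6 : 2 * c = (p : 𝓞 K) * ((r1 + r2 - r3 - r1 * (G - E)) * c - 2 * r4) := by
    linear_combination c * k5 - 2 * k4
  exact ⟨c - l * ((r1 + r2 - r3 - r1 * (G - E)) * c - 2 * r4), by
    linear_combination (-c) * hpl - l * k6⟩

lemma descent {ζ : K} (hζ : IsPrimitiveRoot ζ 8) {p : ℕ} (hp : p.Prime) (h : p ^ 2 % 16 = 9)
    (ε : 𝓞 K) (hε : ε ^ 2 = 1) (n : ℕ) :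
    ∀ a b c : 𝓞 K, a ^ 2 - ε * p * b ^ 2 = hζ.toInteger * c ^ 2 → (p : 𝓞 K) ^ n ∣ c := by
  have h' : p ^ 2 % 8 = 1 := by omega
  have hp0 : (p : 𝓞 K) ≠ 0 := by exact_mod_cast hp.ne_zero
  induction n with
  | zero => intro a b c _; simp
  | succ n ih =>
    intro a b c habc
    obtain ⟨c', hc⟩ : (p : 𝓞 K) ∣ c :=
      dvd_c hζ hp h a c ⟨ε * b ^ 2, by linear_combination habc⟩
    obtain ⟨a', ha⟩ : (p : 𝓞 K) ∣ a := dvd_of_dvd_sq hζ hp h' a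
      ⟨ε * b ^ 2 + hζ.toInteger * p * c' ^ 2, by
        rw [hc] at habc; linear_combination habc⟩
    obtain ⟨b', hb⟩ : (p : 𝓞 K) ∣ b := dvd_of_dvd_sq hζ hp h' b
      ⟨ε * (a' ^ 2 - hζ.toInteger * c' ^ 2), by
        apply mul_left_cancel₀ hp0
        rw [hc, ha] at habc
        linear_combination (- ε) * habc - p * b ^ 2 * hε⟩
    have : (p : 𝓞 K) ^ n ∣ c' := by
      apply ih a' b' c'
      apply mul_left_cancel₀ (pow_ne_zero 2 hp0)
      rw [hc, ha, hb] at habc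
      linear_combination habc
    rw [hc, pow_succ']
    exact mul_dvd_mul_left _ this

lemma not_norm {ζ : K} (hζ : IsPrimitiveRoot ζ 8) {p : ℕ} (hp : p.Prime) (h : p ^ 2 % 16 = 9)
    (ε : 𝓞 K) (hε : ε ^ 2 = 1) (r s : K) : r ^ 2 - (ε : K) * p * s ^ 2 ≠ ζ := by
  intro e
  obtain ⟨a, c1, hc1, rfl⟩ := IsFractionRing.div_surjective (A := 𝓞 K) r
  obtain ⟨b, c2, hc2, rfl⟩ := IsFractionRing.div_surjective (A := 𝓞 K) s
  have hc1' : c1 ≠ 0 := nonZeroDivisors.ne_zero hc1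
  have hc2' : c2 ≠ 0 := nonZeroDivisors.ne_zero hc2
  have hk1 : (algebraMap (𝓞 K) K c1) ≠ 0 := by simpa using hc1'
  have hk2 : (algebraMap (𝓞 K) K c2) ≠ 0 := by simpa using hc2'
  have key : (a * c2) ^ 2 - ε * p * (b * c1) ^ 2 = hζ.toInteger * (c1 * c2) ^ 2 := by
    apply RingOfIntegers.coe_injective
    simp only [map_sub, map_mul, map_pow, map_natCast]
    have : algebraMap (𝓞 K) K hζ.toInteger = ζ := rfl
    rw [this, ← e]
    field_simp
  have hfm := FiniteMultiplicity.of_not_isUnit (natCast_not_isUnit K hp) (mul_ne_zero hc1' hc2')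
  obtain ⟨n, hn⟩ := hfm
  exact hn (descent hζ hp h ε hε (n + 1) _ _ _ key)

lemma not_sq {ζ : K} (hζ : IsPrimitiveRoot ζ 8) {p : ℕ} (hp : p.Prime) (h : p ^ 2 % 16 = 9)
    (ε : 𝓞 K) (hε : ε ^ 2 = 1) (r : K) : r ^ 2 ≠ (ε : K) * p := by
  intro e
  have hrint : IsIntegral ℤ r := by
    apply IsIntegral.of_pow (n := 2) (by norm_num)
    rw [e]
    exact (RingOfIntegers.isIntegral_coe ε).mul (isIntegral_natCast p)
  have h' : p ^ 2 % 8 = 1 := by omega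
  set x : 𝓞 K := ⟨r, hrint⟩
  have hx : x ^ 2 = ε * p := by
    apply RingOfIntegers.coe_injective
    simp only [map_mul, map_pow, map_natCast]
    exact e
  obtain ⟨y, hy⟩ := dvd_of_dvd_sq hζ hp h' x ⟨ε, by rw [hx]; ring⟩
  have hp0 : (p : 𝓞 K) ≠ 0 := by exact_mod_cast hp.ne_zero
  apply natCast_not_isUnit K hp
  refine IsUnit.of_mul_eq_one (ε * y ^ 2) ?_
  apply mul_left_cancel₀ hp0
  rw [hy] at hx
  linear_combination ε * hx + p * hε

end Cyc8

section Index

lemma index_two_ge (M : Type*) [AddCommGroup M] [Module.Finite ℤ M]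
    (hr : 2 ≤ Module.finrank ℤ M) (g : M) (hg : g ≠ 0) (hg2 : (2 : ℤ) • g = 0) :
    8 ≤ (zsmulAddGroupHom (2 : ℤ) : M →+ M).range.index := by
  set S := (zsmulAddGroupHom (2 : ℤ) : M →+ M).range with hS
  have memS : ∀ x, x ∈ S ↔ ∃ y : M, (2 : ℤ) • y = x := fun x => by
    rw [hS, AddMonoidHom.mem_range]; rfl
  set T := Submodule.torsion ℤ M with hT
  have hTfin : Finite T :=
    Module.finite_of_fg_torsion T (Submodule.torsion_isTorsion (R := ℤ) (M := M))
  have hgT : g ∈ T := ⟨⟨2, by simp⟩, hg2⟩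
  obtain ⟨t, ht⟩ : ∃ t : T, ∀ u : T, (2 : ℤ) • u ≠ t := by
    by_contra! hcon
    have hsurj : Function.Surjective (fun u : T => (2 : ℤ) • u) := hcon
    have hinj := Finite.injective_iff_surjective.2 hsurj
    have : (⟨g, hgT⟩ : T) = 0 := hinj (by
      apply Subtype.ext
      simpa using hg2)
    exact hg (congrArg Subtype.val this)
  have hfr : Module.finrank ℤ (M ⧸ T) = Module.finrank ℤ M :=
    finrank_quotient_eq_of_le_torsion le_rfl
  have : Module.IsTorsionFree ℤ (M ⧸ T) := inferInstance
  have : Module.Free ℤ (M ⧸ T) := inferInstance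
  let b := Module.finBasis ℤ (M ⧸ T)
  have hn : 2 ≤ Module.finrank ℤ (M ⧸ T) := hfr ▸ hr
  let i0 : Fin (Module.finrank ℤ (M ⧸ T)) := ⟨0, by omega⟩
  let i1 : Fin (Module.finrank ℤ (M ⧸ T)) := ⟨1, by omega⟩
  have hi : i0 ≠ i1 := by simp [i0, i1]
  obtain ⟨e0, he0⟩ := T.mkQ_surjective (b i0)
  obtain ⟨e1, he1⟩ := T.mkQ_surjective (b i1)
  have key : ∀ x y z : ℤ, x • (t : M) + y • e0 + z • e1 ∈ S → Even x ∧ Even y ∧ Even z := by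
    intro x y z h
    obtain ⟨m, hm⟩ := (memS _).1 h
    have h1 := congrArg T.mkQ hm
    have ht0 : T.mkQ (t : M) = 0 := by simp
    simp only [map_add, map_zsmul, ht0, he0, he1, smul_zero, zero_add] at h1
    have hy : y = 2 * b.repr (T.mkQ m) i0 := by
      have := congrArg (fun v => b.repr v i0) h1
      simpa [hi, hi.symm, Finsupp.single_apply, eq_comm] using this
    have hz : z = 2 * b.repr (T.mkQ m) i1 := by
      have := congrArg (fun v => b.repr v i1) h1
      simpa [hi, hi.symm, Finsupp.single_apply, eq_comm] using this
    refine ⟨?_, ⟨_, hy.trans (two_mul _)⟩, ⟨_, hz.trans (two_mul _)⟩⟩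
    by_contra hx
    rw [Int.not_even_iff_odd] at hx
    obtain ⟨k, hk⟩ := hx
    set y' := b.repr (T.mkQ m) i0
    set z' := b.repr (T.mkQ m) i1
    have h2 : (2 : ℤ) • (m - k • (t : M) - y' • e0 - z' • e1) = (t : M) := by
      simp only [smul_sub, hm, smul_smul, hk, hy, hz, add_smul]
      module
    have h3 : m - k • (t : M) - y' • e0 - z' • e1 ∈ T := by
      obtain ⟨c, hc⟩ := (Submodule.mem_torsion_iff _).1 t.2
      refine ⟨⟨2 * c, mul_mem (by simp) c.2⟩, ?_⟩
      have : (2 * (c : ℤ)) • (m - k • (t : M) - y' • e0 - z' • e1) = 0 := by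
        rw [mul_comm, mul_smul, h2]; exact hc
      exact this
    exact ht ⟨_, h3⟩ (Subtype.ext h2)
  have hfin : Finite (M ⧸ S) := by
    have : Module.Finite ℤ (M ⧸ S) :=
      Module.Finite.of_surjective (QuotientAddGroup.mk' S).toIntLinearMap
        (QuotientAddGroup.mk'_surjective S)
    apply Module.finite_of_fg_torsion
    intro x
    obtain ⟨m, rfl⟩ := QuotientAddGroup.mk_surjective x
    refine ⟨⟨2, by simp⟩, ?_⟩
    have : ((((2 : ℤ) • m : M)) : M ⧸ S) = 0 := (QuotientAddGroup.eq_zero_iff _).2 ((memS _).2 ⟨m, rfl⟩)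
    exact this
  let f : Fin 2 × Fin 2 × Fin 2 → M ⧸ S := fun v =>
    QuotientAddGroup.mk (((v.1 : ℕ) : ℤ) • (t : M) + ((v.2.1 : ℕ) : ℤ) • e0 + ((v.2.2 : ℕ) : ℤ) • e1)
  have hf : Function.Injective f := by
    rintro ⟨x, y, z⟩ ⟨x', y', z'⟩ h
    have h1 := QuotientAddGroup.eq.1 h
    have h2 := key (((x' : ℕ) : ℤ) - ((x : ℕ) : ℤ)) (((y' : ℕ) : ℤ) - ((y : ℕ) : ℤ))
      (((z' : ℕ) : ℤ) - ((z : ℕ) : ℤ)) (by convert h1 using 1; dsimp only; module)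
    obtain ⟨⟨a, ha⟩, ⟨b, hb⟩, ⟨c, hc⟩⟩ := h2
    ext <;> dsimp only <;> omega
  have := Nat.card_le_card_of_injective f hf
  simpa [AddSubgroup.index, Nat.card_eq_fintype_card] using this

lemma index_sq_ge (H : Type*) [CommGroup H] [Module.Finite ℤ (Additive H)]
    (hr : 2 ≤ Module.finrank ℤ (Additive H)) (g : H) (hg : g ≠ 1) (hg2 : g ^ 2 = 1) :
    8 ≤ (powMonoidHom 2 : H →* H).range.index := by
  have := index_two_ge (Additive H) hr (Additive.ofMul g) (by simpa using hg) (by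
    apply Additive.toMul.injective
    simpa using hg2)
  convert this using 1
  rw [← Subgroup.index_toAddSubgroup]
  congr 1
  ext x
  rw [AddMonoidHom.mem_range]
  change x.toMul ∈ (powMonoidHom 2 : H →* H).range ↔ _
  rw [MonoidHom.mem_range]
  constructor
  · rintro ⟨y, hy⟩
    refine ⟨Additive.ofMul y, ?_⟩
    apply Additive.toMul.injective
    simpa using hy
  · rintro ⟨y, hy⟩
    refine ⟨y.toMul, ?_⟩
    rw [← hy]
    simp

lemma relIndex_sq (G : Type*) [CommGroup G] (H : Subgroup G) :
    (H.map (powMonoidHom 2 : G →* G)).relIndex H = (powMonoidHom 2 : H →* H).range.index := by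
  rw [Subgroup.relIndex]
  congr 1
  ext x
  simp only [Subgroup.mem_subgroupOf, Subgroup.mem_map, MonoidHom.mem_range]
  constructor
  · rintro ⟨y, hy, h⟩
    exact ⟨⟨y, hy⟩, Subtype.ext h⟩
  · rintro ⟨y, rfl⟩
    exact ⟨y, y.2, rfl⟩

/-- kernel of an endomorphism whose range lies in a cyclic-rank-one subgroup -/
lemma relIndex_ker_ge (G G' : Type*) [CommGroup G] [CommGroup G'] [Module.Finite ℤ (Additive G)]
    [Module.Finite ℤ (Additive G')]
    (N : G →* G) (ι : G' →* G) (hι : N.range ≤ ι.range) (h3 : 3 ≤ Module.finrank ℤ (Additive G))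
    (h1 : Module.finrank ℤ (Additive G') ≤ 1) (g : G) (hg : g ≠ 1) (hg2 : g ^ 2 = 1)
    (hgN : N g = 1) :
    8 ≤ (N.ker.map (powMonoidHom 2 : G →* G)).relIndex N.ker := by
  rw [relIndex_sq]
  let f : Additive G →ₗ[ℤ] Additive G := (MonoidHom.toAdditive N).toIntLinearMap
  let i : Additive G' →ₗ[ℤ] Additive G := (MonoidHom.toAdditive ι).toIntLinearMap
  let j : Additive N.ker →ₗ[ℤ] Additive G := (MonoidHom.toAdditive N.ker.subtype).toIntLinearMap
  have hj : Function.Injective j := N.ker.subtype_injective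
  have hjr : LinearMap.range j = LinearMap.ker f := by
    ext x
    constructor
    · rintro ⟨y, rfl⟩
      exact y.toMul.2
    · intro hx
      exact ⟨Additive.ofMul ⟨x.toMul, hx⟩, rfl⟩
  have hfin : Module.Finite ℤ (Additive N.ker) := Module.Finite.of_injective j hj
  have hrank := (LinearMap.ker f).finrank_quotient_add_finrank
  rw [f.quotKerEquivRange.finrank_eq] at hrank
  have hfi : LinearMap.range f ≤ LinearMap.range i := by
    rintro _ ⟨y, rfl⟩
    obtain ⟨z, hz⟩ := hι ⟨y.toMul, rfl⟩
    exact ⟨Additive.ofMul z, hz⟩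
  have hle := Submodule.finrank_mono hfi
  have hle2 := LinearMap.finrank_range_le i
  have hk := LinearMap.finrank_range_of_inj hj
  rw [hjr] at hk
  apply index_sq_ge _ (by omega) ⟨g, hgN⟩
  · intro h; exact hg (congrArg Subtype.val h)
  · exact Subtype.ext hg2

lemma index_sq_le (G : Type*) [CommGroup G] (t u : G) (h : ∀ x : G, ∃ a b : ℤ, x = t ^ a * u ^ b) :
    (powMonoidHom 2 : G →* G).range.index ≠ 0 ∧ (powMonoidHom 2 : G →* G).range.index ≤ 4 := by
  set S := (powMonoidHom 2 : G →* G).range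
  let f : Fin 2 × Fin 2 → G ⧸ S := fun v => QuotientGroup.mk (t ^ (v.1 : ℕ) * u ^ (v.2 : ℕ))
  have hf : Function.Surjective f := by
    intro x
    obtain ⟨m, rfl⟩ := QuotientGroup.mk_surjective x
    obtain ⟨a, b, rfl⟩ := h m
    refine ⟨(⟨(a % 2).toNat, by omega⟩, ⟨(b % 2).toNat, by omega⟩), ?_⟩
    rw [QuotientGroup.eq]
    refine ⟨t ^ (a / 2) * u ^ (b / 2), ?_⟩
    have ha : (((a % 2).toNat : ℕ) : ℤ) = a % 2 := by omega
    have hb : (((b % 2).toNat : ℕ) : ℤ) = b % 2 := by omega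
    simp only [powMonoidHom_apply]
    rw [← zpow_natCast t, ← zpow_natCast u, ha, hb, mul_pow, mul_inv]
    have e1 : t ^ a = t ^ (a % 2) * (t ^ (a / 2)) ^ 2 := by
      rw [← zpow_natCast, ← zpow_mul, ← zpow_add]; congr 1; push_cast; omega
    have e2 : u ^ b = u ^ (b % 2) * (u ^ (b / 2)) ^ 2 := by
      rw [← zpow_natCast, ← zpow_mul, ← zpow_add]; congr 1; push_cast; omega
    rw [e1, e2, ← mul_inv, eq_inv_mul_iff_mul_eq]
    exact mul_mul_mul_comm _ _ _ _
  have hfin : Finite (G ⧸ S) := Finite.of_surjective f hf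
  refine ⟨?_, ?_⟩
  · rw [Subgroup.index]; exact Nat.card_pos.ne'
  · have := Nat.card_le_card_of_surjective f hf
    simpa [Subgroup.index] using this

end Index

section Concrete

lemma prime_absNorm_aux {L : Type*} [Field L] [NumberField L] {p : ℕ}
    (hp8 : p % 8 = 3 ∨ p % 8 = 5) (z : 𝓞 L) (hz : z ^ 4 = -1) (P : Ideal (𝓞 L)) [hP : P.IsPrime]
    (hP0 : P ≠ ⊥) (h : Ideal.absNorm P = p) : False := by
  have hmax : P.IsMaximal := hP.isMaximal hP0
  letI : Field (𝓞 L ⧸ P) := Ideal.Quotient.field P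
  have hc : Nat.card (𝓞 L ⧸ P) = p := by
    rw [← h, Ideal.absNorm_apply, Submodule.cardQuot_apply]
  have hp0 : p ≠ 0 := by omega
  have : Finite (𝓞 L ⧸ P) := Nat.finite_of_card_ne_zero (by rw [hc]; exact hp0)
  letI := Fintype.ofFinite (𝓞 L ⧸ P)
  set w := Ideal.Quotient.mk P z with hw
  have hw4 : w ^ 4 = -1 := by rw [hw, ← map_pow, hz, map_neg, map_one]
  have hwp : w ^ p = w := by
    have := FiniteField.pow_card w
    rwa [← Nat.card_eq_fintype_card, hc] at this
  have hw0 : w ≠ 0 := by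
    intro h0; rw [h0] at hw4; norm_num at hw4
  have hw8 : w ^ 8 = 1 := by
    linear_combination (w ^ 4 - 1) * hw4
  have h1 : w ^ 4 = 1 := by
    have e : w ^ p = w ^ (p % 8) := by
      conv_lhs => rw [← Nat.div_add_mod p 8, pow_add, pow_mul, hw8, one_pow, one_mul]
    rw [hwp] at e
    rcases hp8 with h3 | h5
    · rw [h3] at e
      have : w ^ 2 = 1 := mul_left_cancel₀ hw0 (by linear_combination -e)
      linear_combination (w ^ 2 + 1) * this
    · rw [h5] at e
      exact mul_left_cancel₀ hw0 (by linear_combination -e)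
  have h2 : (2 : 𝓞 L ⧸ P) = 0 := by linear_combination hw4 - h1
  have hpz : (p : 𝓞 L ⧸ P) = 0 := by
    have := Ideal.absNorm_mem P
    rw [h] at this
    simpa using Ideal.Quotient.eq_zero_iff_mem.2 this
  obtain ⟨k, hk⟩ : ∃ k, p = 2 * k + 1 := ⟨p / 2, by omega⟩
  rw [hk] at hpz
  push_cast at hpz
  rw [h2] at hpz
  simp at hpz

lemma divisors_le {L : Type*} [Field L] [NumberField L] (hL : Module.finrank ℚ L = 8) {p : ℕ}
    (hp : p.Prime) (hp8 : p % 8 = 3 ∨ p % 8 = 5) (z : 𝓞 L) (hz : z ^ 4 = -1)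
    (δ : 𝓞 L) (hδ : δ ^ 4 = (p : 𝓞 L) ^ 2) :
    {C : Ideal (𝓞 L) | C ∣ Ideal.span {δ}}.Finite ∧
    {C : Ideal (𝓞 L) | C ∣ Ideal.span {δ}}.ncard ≤ 4 := by
  classical
  have hN : Ideal.absNorm (Ideal.span {δ}) = p ^ 4 := by
    have h1 : Ideal.absNorm (Ideal.span {δ}) ^ 4 = (p ^ 4) ^ 4 := by
      rw [← map_pow, Ideal.span_singleton_pow, hδ, ← Ideal.span_singleton_pow, map_pow,
        Ideal.absNorm_span_natCast, RingOfIntegers.rank, hL]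
      ring
    exact Nat.pow_left_injective (n := 4) (by norm_num) h1
  have hδ0 : δ ≠ 0 := by
    rintro rfl
    have : (p : 𝓞 L) ≠ 0 := by exact_mod_cast hp.ne_zero
    exact this (pow_eq_zero_iff (n := 2) (by norm_num) |>.1 (by rw [← hδ]; norm_num))
  have hI0 : Ideal.span {δ} ≠ 0 := by
    rwa [Ideal.zero_eq_bot, Ne, Ideal.span_singleton_eq_bot]
  set I := Ideal.span {δ} with hI
  let m := UniqueFactorizationMonoid.normalizedFactors I
  have hfac : ∀ P ∈ m, p ^ 2 ∣ Ideal.absNorm P := by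
    intro P hP
    have hPp := UniqueFactorizationMonoid.prime_of_normalized_factor P hP
    have hdvd := UniqueFactorizationMonoid.dvd_of_mem_normalizedFactors hP
    have hP1 : P.IsPrime := Ideal.isPrime_of_prime hPp
    have hd : Ideal.absNorm P ∣ p ^ 4 := by
      rw [← hN]; exact map_dvd Ideal.absNorm hdvd
    obtain ⟨k, -, hk⟩ := (Nat.dvd_prime_pow hp).1 hd
    rw [hk]
    apply pow_dvd_pow
    have hk0 : k ≠ 0 := by
      rintro rfl
      rw [pow_zero, Ideal.absNorm_eq_one_iff] at hk
      exact hP1.ne_top hk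
    have hk1 : k ≠ 1 := by
      rintro rfl
      rw [pow_one] at hk
      exact prime_absNorm_aux hp8 z hz P hPp.ne_zero hk
    omega
  have hprod : m.prod = I := associated_iff_eq.1
    (UniqueFactorizationMonoid.prod_normalizedFactors hI0)
  have hcard : m.card ≤ 2 := by
    have h1 : (p ^ 2) ^ m.card ∣ p ^ 4 := by
      rw [← hN, ← hprod, map_multiset_prod]
      clear_value m
      clear hprod
      induction m using Multiset.induction_on with
      | empty => simp
      | cons a s ih =>
        rw [Multiset.card_cons, pow_succ', Multiset.map_cons, Multiset.prod_cons]
        exact mul_dvd_mul (hfac a (Multiset.mem_cons_self a s))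
          (ih fun P hP => hfac P (Multiset.mem_cons_of_mem hP))
    rw [← pow_mul] at h1
    have := (Nat.pow_dvd_pow_iff_le_right hp.one_lt).1 h1
    omega
  have hsub : {C : Ideal (𝓞 L) | C ∣ I} ⊆ ((m.powerset.map Multiset.prod).toFinset : Set _) := by
    intro C hC
    have hC0 : C ≠ 0 := ne_zero_of_dvd_ne_zero hI0 hC
    rw [Finset.mem_coe, Multiset.mem_toFinset, Multiset.mem_map]
    refine ⟨UniqueFactorizationMonoid.normalizedFactors C, ?_, ?_⟩
    · rw [Multiset.mem_powerset]
      exact (UniqueFactorizationMonoid.dvd_iff_normalizedFactors_le_normalizedFactors hC0 hI0).1 hC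
    · exact associated_iff_eq.1 (UniqueFactorizationMonoid.prod_normalizedFactors hC0)
  refine ⟨(Finset.finite_toSet _).subset hsub, ?_⟩
  refine (Set.ncard_le_ncard hsub (Finset.finite_toSet _)).trans ?_
  rw [Set.ncard_coe_finset]
  refine (Multiset.toFinset_card_le _).trans ?_
  rw [Multiset.card_map, Multiset.card_powerset]
  calc 2 ^ m.card ≤ 2 ^ 2 := Nat.pow_le_pow_right (by norm_num) hcard
    _ = 4 := by norm_num

lemma rank_of_root {L : Type*} [Field L] [NumberField L] {ζ : L} (hζ : IsPrimitiveRoot ζ 8) :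
    Module.finrank ℚ L = 2 * (Units.rank L + 1) := by
  have h1 := InfinitePlace.IsPrimitiveRoot.nrRealPlaces_eq_zero_of_two_lt (by norm_num) hζ
  have h2 := InfinitePlace.card_add_two_mul_card_eq_rank L
  have h3 := InfinitePlace.card_eq_nrRealPlaces_add_nrComplexPlaces L
  have h4 : 0 < Module.finrank ℚ L := Module.finrank_pos
  unfold Units.rank
  omega

lemma units_gen (K : Type*) [Field K] [NumberField K] (h : Units.rank K = 1) :
    ∃ t u : (𝓞 K)ˣ, ∀ x, ∃ a b : ℤ, x = t ^ a * u ^ b := by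
  obtain ⟨t, ht⟩ := IsCyclic.exists_generator (α := Units.torsion K)
  let i0 : Fin (Units.rank K) := ⟨0, by omega⟩
  have huniv : ∀ i, i = i0 := fun i => Fin.ext (by have := i.2; simp only [i0]; omega)
  refine ⟨t, Units.fundSystem K i0, fun x => ?_⟩
  obtain ⟨⟨c, e⟩, hc, -⟩ := Units.exist_unique_eq_mul_prod K x
  obtain ⟨a, ha⟩ := Subgroup.mem_zpowers_iff.1 (ht c)
  refine ⟨a, e i0, ?_⟩
  rw [hc]
  dsimp only
  rw [← ha, Fintype.prod_eq_single i0 (fun i hi => absurd (huniv i) hi)]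
  simp

end Concrete

section Final

lemma odd_of_sq (B : Type*) [CommRing B] [IsDedekindDomain B] [Finite (ClassGroup B)]
    (h : ∀ (I : Ideal B), I ≠ ⊥ → ∀ m, I * I = Ideal.span {m} → ∃ j, I = Ideal.span {j}) :
    Odd (Nat.card (ClassGroup B)) := by
  rw [← Nat.not_even_iff_odd, even_iff_two_dvd]
  intro h2
  have : Fact (Nat.Prime 2) := ⟨Nat.prime_two⟩
  obtain ⟨x, hx⟩ := exists_prime_orderOf_dvd_card' 2 h2
  obtain ⟨I, rfl⟩ := ClassGroup.mk0_surjective x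
  have hsq : ClassGroup.mk0 (I * I) = 1 := by
    rw [map_mul, ← pow_two, ← hx, pow_orderOf_eq_one]
  rw [ClassGroup.mk0_eq_one_iff] at hsq
  obtain ⟨m, hm⟩ := hsq
  obtain ⟨j, hj⟩ := h I (nonZeroDivisors.coe_ne_zero I) m hm
  have h1 : ClassGroup.mk0 I = 1 := by
    rw [ClassGroup.mk0_eq_one_iff]
    exact ⟨⟨j, hj⟩⟩
  rw [h1, orderOf_one] at hx
  norm_num at hx

lemma main_quad {K L : Type*} [Field K] [NumberField K] [IsCyclotomicExtension {8} ℚ K]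
    [Field L] [NumberField L] [Algebra K L] {ζ : K} (hζ : IsPrimitiveRoot ζ 8) {p : ℕ}
    (hp : p.Prime) (hp8 : p % 8 = 3 ∨ p % 8 = 5) (ε : 𝓞 K) (hε : ε ^ 2 = 1)
    (θ : 𝓞 L) (δ : L) (hθ : 2 * (θ : L) = 1 + δ)
    (hδ : δ ^ 2 = algebraMap K L (ε * p))
    (hspan : ∀ x : L, ∃ r t : K, x = algebraMap K L r + algebraMap K L t * δ) :
    Odd (Nat.card (ClassGroup (𝓞 L))) := by
  have hp16 : p ^ 2 % 16 = 9 := by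
    have h16 : p % 16 = 3 ∨ p % 16 = 11 ∨ p % 16 = 5 ∨ p % 16 = 13 := by omega
    rw [pow_two, Nat.mul_mod]
    rcases h16 with h | h | h | h <;> rw [h]
  have hδK : ∀ r : K, algebraMap K L r ≠ δ := by
    intro r hr
    apply not_sq hζ hp hp16 ε hε r
    apply (algebraMap K L).injective
    rw [map_pow, hr, hδ]
  have hδ0 : δ ≠ 0 := fun h => hδK 0 (by rw [map_zero, h])
  have hfinK : Module.finrank ℚ K = 4 := by
    rw [IsCyclotomicExtension.Rat.finrank 8 K]; decide
  have h2 : Module.finrank K L = 2 := by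
    have hle : Module.finrank K L ≤ 2 := by
      have hs : Submodule.span K (Set.range ![(1 : L), δ]) = ⊤ := by
        rw [eq_top_iff]
        rintro x -
        obtain ⟨r, t, rfl⟩ := hspan x
        rw [← Algebra.smul_def, Algebra.algebraMap_eq_smul_one]
        refine add_mem (Submodule.smul_mem _ _ (Submodule.subset_span ⟨0, rfl⟩))
          (Submodule.smul_mem _ _ (Submodule.subset_span ⟨1, rfl⟩))
      have := finrank_range_le_card (R := K) ![(1 : L), δ]
      rw [Set.finrank, hs, finrank_top] at this
      simpa using this
    have hne : Module.finrank K L ≠ 1 := by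
      intro h1
      have hb := Subalgebra.bot_eq_top_iff_finrank_eq_one.2 h1
      have : δ ∈ (⊥ : Subalgebra K L) := hb ▸ Algebra.mem_top
      obtain ⟨r, hr⟩ := Algebra.mem_bot.1 this
      exact hδK r hr
    have hpos : 0 < Module.finrank K L := Module.finrank_pos
    omega
  have hquad : Algebra.IsQuadraticExtension K L := ⟨h2⟩
  have hfinL : Module.finrank ℚ L = 8 := by
    rw [← Module.finrank_mul_finrank ℚ K L, hfinK, h2]
  obtain ⟨τ, hτ⟩ : ∃ τ : L ≃ₐ[K] L, τ δ ≠ δ := by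
    by_contra! hcon
    have := (IsGalois.mem_bot_iff_fixed (F := K) δ).2 hcon
    obtain ⟨r, hr⟩ := IntermediateField.mem_bot.1 this
    exact hδK r hr
  have hτδ : τ δ = -δ := by
    have : τ δ ^ 2 = δ ^ 2 := by rw [← map_pow, hδ, AlgEquiv.commutes]
    exact (sq_eq_sq_iff_eq_or_eq_neg.1 this).resolve_left hτ
  have hττ : ∀ x, τ (τ x) = x := by
    intro x
    obtain ⟨r, t, rfl⟩ := hspan x
    simp [hτδ]
  have hτfix : ∀ x, τ x = x → ∃ r : K, algebraMap K L r = x := by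
    intro x hx
    obtain ⟨r, t, rfl⟩ := hspan x
    simp only [map_add, map_mul, AlgEquiv.commutes, hτδ] at hx
    have h0 : algebraMap K L t * δ = 0 := by
      have : (2 : L) * (algebraMap K L t * δ) = 0 := by linear_combination -hx
      simpa using this
    exact ⟨r, by rw [h0, add_zero]⟩
  let σ : 𝓞 L ≃+* 𝓞 L := RingOfIntegers.mapRingEquiv (τ : L ≃+* L)
  have hσc : ∀ x : 𝓞 L, ((σ x : 𝓞 L) : L) = τ x := fun x => rfl
  have hσ : ∀ x, σ (σ x) = x := fun x => RingOfIntegers.ext (by rw [hσc, hσc, hττ])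
  have hac : ∀ a : 𝓞 K, ((algebraMap (𝓞 K) (𝓞 L) a : 𝓞 L) : L) = algebraMap K L (a : K) :=
    fun a => rfl
  have hfix : ∀ x, σ x = x ↔ ∃ a : 𝓞 K, algebraMap (𝓞 K) (𝓞 L) a = x := by
    intro x
    constructor
    · intro hx
      have hx' : τ (x : L) = x := by rw [← hσc, hx]
      obtain ⟨r, hr⟩ := hτfix _ hx'
      have hrint : IsIntegral ℤ r := by
        have h1 : IsIntegral ℤ (algebraMap K L r) := by
          rw [hr]; exact RingOfIntegers.isIntegral_coe x
        exact (isIntegral_algebraMap_iff (algebraMap K L).injective).1 h1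
      exact ⟨⟨r, hrint⟩, RingOfIntegers.ext hr⟩
    · rintro ⟨a, rfl⟩
      apply RingOfIntegers.ext
      rw [hσc, hac, AlgEquiv.commutes]
  have hθσ : ((θ - σ θ : 𝓞 L) : L) = δ := by
    have e1 : τ (2 * (θ : L)) = 1 - δ := by rw [hθ, map_add, map_one, hτδ, sub_eq_add_neg]
    rw [map_mul, map_ofNat, ← hσc] at e1
    have : (2 : L) * ((θ - σ θ : 𝓞 L) : L) = 2 * δ := by
      push_cast
      linear_combination hθ - e1
    exact mul_left_cancel₀ two_ne_zero this
  have hθ0 : θ - σ θ ≠ 0 := by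
    intro h; rw [h] at hθσ; exact hδ0 (by rw [← hθσ]; rfl)
  have hpid := eight_pid K
  have hζL : IsPrimitiveRoot (algebraMap K L ζ) 8 := hζ.map_of_injective (algebraMap K L).injective
  have hrK : Units.rank K = 1 := by
    have := rank_of_root hζ; omega
  have hrL : Units.rank L = 3 := by
    have := rank_of_root hζL; omega
  -- the fixed units
  let ι : (𝓞 K)ˣ →* (𝓞 L)ˣ := Units.map (algebraMap (𝓞 K) (𝓞 L) : 𝓞 K →* 𝓞 L)
  have hinj : Function.Injective (algebraMap (𝓞 K) (𝓞 L)) := by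
    intro a b hab
    apply RingOfIntegers.ext
    apply (algebraMap K L).injective
    rw [← hac, ← hac, hab]
  have hιi : Function.Injective ι := Units.map_injective hinj
  have hιr : ι.range = uF σ := by
    ext x
    rw [mem_uF, MonoidHom.mem_range]
    constructor
    · rintro ⟨u, rfl⟩
      exact (hfix _).2 ⟨u, rfl⟩
    · intro hx
      obtain ⟨a, ha⟩ := (hfix _).1 hx
      have hx' : σ ((x⁻¹ : (𝓞 L)ˣ) : 𝓞 L) = ((x⁻¹ : (𝓞 L)ˣ) : 𝓞 L) := by
        rw [← mem_uF]
        exact inv_mem ((mem_uF σ x).2 hx)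
      obtain ⟨b, hb⟩ := (hfix _).1 hx'
      have hab : a * b = 1 := hinj (by rw [map_mul, ha, hb, map_one, Units.mul_inv])
      exact ⟨⟨a, b, hab, by rw [mul_comm, hab]⟩, Units.ext ha⟩
  have hidx : (sqs (uF σ)).relIndex (uF σ) = (powMonoidHom 2 : (𝓞 K)ˣ →* (𝓞 K)ˣ).range.index := by
    rw [← hιr]
    have e1 : sqs ι.range = ((powMonoidHom 2 : (𝓞 K)ˣ →* (𝓞 K)ˣ).range).map ι := by
      ext x
      constructor
      · rintro ⟨_, ⟨u, rfl⟩, rfl⟩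
        exact ⟨u ^ 2, ⟨u, rfl⟩, map_pow ι u 2⟩
      · rintro ⟨_, ⟨u, rfl⟩, rfl⟩
        exact ⟨ι u, ⟨u, rfl⟩, (map_pow ι u 2).symm⟩
    rw [e1, MonoidHom.range_eq_map ι, Subgroup.relIndex_map_map_of_injective _ _ hιi,
      Subgroup.relIndex_top_right]
  obtain ⟨t, u, htu⟩ := units_gen K hrK
  obtain ⟨hF0, hF4⟩ := index_sq_le _ t u htu
  rw [← hidx] at hF0 hF4
  have hH : 8 ≤ (sqs (uN σ).ker).relIndex (uN σ).ker := by
    apply relIndex_ker_ge (𝓞 L)ˣ (𝓞 K)ˣ (uN σ) ι ?_ ?_ ?_ (-1)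
    · intro h
      have := congrArg (fun u : (𝓞 L)ˣ => ((u : 𝓞 L) : L)) h
      norm_num at this
    · norm_num
    · rw [← MonoidHom.mem_ker, mem_uN_ker]
      simp
    · rw [hιr]
      rintro _ ⟨x, rfl⟩
      rw [mem_uF]
      change σ ((x : 𝓞 L) * σ x) = (x : 𝓞 L) * σ x
      rw [map_mul, hσ, mul_comm]
    · rw [Units.finrank_eq, hrL]
    · rw [Units.finrank_eq, hrK]
  -- divisors
  let z0 := hζ.toInteger
  have hz8 : z0 ^ 8 = 1 := hζ.toInteger_isPrimitiveRoot.pow_eq_one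
  have hz4 : z0 ^ 4 = -1 := by
    have h4 : z0 ^ 4 ≠ 1 := hζ.toInteger_isPrimitiveRoot.pow_ne_one_of_pos_of_lt (by norm_num) (by norm_num)
    have h0 : (z0 ^ 4 - 1) * (z0 ^ 4 + 1) = 0 := by linear_combination hz8
    exact eq_neg_of_add_eq_zero_left ((mul_eq_zero.1 h0).resolve_left (sub_ne_zero.2 h4))
  obtain ⟨hfin, hdiv⟩ := divisors_le hfinL hp hp8 (algebraMap (𝓞 K) (𝓞 L) z0)
    (by rw [← map_pow, hz4, map_neg, map_one]) (θ - σ θ) (by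
      apply RingOfIntegers.ext
      have e1 : (((θ - σ θ) ^ 4 : 𝓞 L) : L) = δ ^ 4 := by rw [← hθσ]; push_cast; rfl
      rw [e1]
      have e2 : δ ^ 4 = algebraMap K L ((ε ^ 2 : 𝓞 K) * p ^ 2) := by
        have : δ ^ 4 = (δ ^ 2) ^ 2 := by ring
        rw [this, hδ, ← map_pow]
        congr 1
        push_cast
        ring
      rw [e2, hε]
      simp)
  let z : (𝓞 L)ˣ := ι ⟨z0, z0 ^ 7, by rw [← pow_succ', hz8], by rw [← pow_succ, hz8]⟩
  have hzL : ((z : 𝓞 L) : L) = algebraMap K L ζ := rfl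
  obtain ⟨hP, hS⟩ := unit_count (A := 𝓞 K) σ hσ hfix θ hθ0 hF0 hF4 hH hfin hdiv z
    ((hfix _).2 ⟨z0, rfl⟩) (by
      intro a c hac'
      by_contra hc
      have hc' : (c : L) ≠ 0 := by
        intro h; exact hc (RingOfIntegers.ext h)
      have hcσ : τ (c : L) ≠ 0 := by simpa using hc'
      have e := congrArg (fun x : 𝓞 L => (x : L)) hac'
      have e' : algebraMap K L ζ * ((c : L) * τ c) = a * τ a := e
      obtain ⟨r, s, hrs⟩ := hspan ((a : L) / c)
      apply not_norm hζ hp hp16 ε hε r s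
      apply (algebraMap K L).injective
      have e3 : ((a : L) / c) * τ ((a : L) / c) = algebraMap K L ζ := by
        rw [map_div₀]
        field_simp
        rw [← e']
        ring
      rw [← e3, hrs]
      simp only [map_add, map_mul, map_sub, map_pow, AlgEquiv.commutes, hτδ, map_natCast]
      rw [map_mul, map_natCast] at hδ
      linear_combination (algebraMap K L s) ^ 2 * hδ)
  exact odd_of_sq _ fun I hI m hm => principal_of_sq (A := 𝓞 K) σ hσ hfix θ hθ0 hP hS I hI m hm

end Final

theorem stmt_14 (p : ℕ) (hp : p.Prime) (hp8 : p % 8 = 3 ∨ p % 8 = 5)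
    (L : Type) [Field L] [NumberField L]
    (ζ : L) (hζ : IsPrimitiveRoot ζ 8) (s : L) (hs : s ^ 2 = (p : L))
    (hgen : Algebra.adjoin ℚ {ζ, s} = ⊤) :
    Odd (Nat.card (ClassGroup (𝓞 L))) := by
  let K := IntermediateField.adjoin ℚ {ζ}
  have hcyc : IsCyclotomicExtension {8} ℚ K := hζ.intermediateField_adjoin_isCyclotomicExtension ℚ
  let ζ' : K := ⟨ζ, IntermediateField.mem_adjoin_simple_self ℚ ζ⟩
  have hζ' : IsPrimitiveRoot ζ' 8 := IsPrimitiveRoot.coe_submonoidClass_iff.mp hζ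
  have hmap : algebraMap K L ζ' = ζ := rfl
  have hz4 : ζ ^ 4 = -1 := by
    have h4 : ζ ^ 4 ≠ 1 := hζ.pow_ne_one_of_pos_of_lt (by norm_num) (by norm_num)
    have h0 : (ζ ^ 4 - 1) * (ζ ^ 4 + 1) = 0 := by linear_combination hζ.pow_eq_one
    exact eq_neg_of_add_eq_zero_left ((mul_eq_zero.1 h0).resolve_left (sub_ne_zero.2 h4))
  -- the common data
  obtain ⟨n, ε, hε, hn, δ, hδ, w, hw⟩ : ∃ (n : ℤ) (ε : ℤ), ε ^ 2 = 1 ∧ ε * p = 1 + 4 * n ∧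
      ∃ δ : L, δ ^ 2 = ε * p ∧ ∃ w : K, s = algebraMap K L w * δ := by
    rcases hp8 with h | h
    · refine ⟨-((p : ℤ) / 4) - 1, -1, by norm_num, by omega, ζ ^ 2 * s, ?_, -ζ' ^ 2, ?_⟩
      · push_cast
        linear_combination (ζ ^ 4) * hs + (p : L) * hz4
      · rw [map_neg, map_pow, hmap]
        linear_combination s * hz4
    · refine ⟨(p : ℤ) / 4, 1, by norm_num, by omega, s, by rw [hs]; simp, 1, by simp⟩
  have hn' : (ε : L) * p = 1 + 4 * n := by exact_mod_cast hn
  have hrint : IsIntegral ℤ ((1 + δ) / 2) := by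
    refine ⟨Polynomial.X ^ 2 - Polynomial.X - Polynomial.C n, by monicity!, ?_⟩
    simp only [Polynomial.eval₂_sub, Polynomial.eval₂_pow, Polynomial.eval₂_X, Polynomial.eval₂_C]
    rw [eq_intCast]
    linear_combination (1 / 4 : L) * hδ + (1 / 4 : L) * hn'
  refine main_quad (K := K) hζ' hp hp8 (ε : 𝓞 K) (by exact_mod_cast hε) ⟨_, hrint⟩ δ
    (by change 2 * ((1 + δ) / 2) = 1 + δ; ring) (by rw [hδ]; simp) ?_
  intro x
  have hx : x ∈ Algebra.adjoin ℚ {ζ, s} := hgen ▸ Algebra.mem_top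
  induction hx using Algebra.adjoin_induction with
  | mem x hx =>
    rcases hx with rfl | rfl
    · exact ⟨ζ', 0, by simp [hmap]⟩
    · exact ⟨0, w, by rw [map_zero, zero_add]; exact hw⟩
  | algebraMap q => exact ⟨algebraMap ℚ K q, 0, by simp⟩
  | add x y _ _ hx hy =>
    obtain ⟨r, t, rfl⟩ := hx
    obtain ⟨r', t', rfl⟩ := hy
    exact ⟨r + r', t + t', by rw [map_add, map_add]; ring⟩
  | mul x y _ _ hx hy =>
    obtain ⟨r, t, rfl⟩ := hx
    obtain ⟨r', t', rfl⟩ := hy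
    refine ⟨r * r' + t * t' * (ε * p), r * t' + t * r', ?_⟩
    simp only [map_add, map_mul, map_intCast, map_natCast]
    linear_combination (algebraMap K L t * algebraMap K L t') * hδ
end

section
/- Let $p$ be a prime with $p \equiv 7 \pmod 8$. Then the 2-class group of $L_p = \mathbb{Q}(\zeta_8, \sqrt{p})$ is cyclic and nontrivial. -/
open NumberField

section

lemma A_card_ker {G : Type*} [CommGroup G] [Finite G]
    (h : Nat.card (powMonoidHom 2 : G →* G).ker ≤ 2) (k : ℕ) :
    Nat.card (powMonoidHom (2 ^ k) : G →* G).ker ≤ 2 ^ k := by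
  induction k with
  | zero =>
    have : (powMonoidHom (2 ^ 0) : G →* G).ker = ⊥ := by
      ext x; simp [MonoidHom.mem_ker]
    rw [this]; simp
  | succ k ih =>
    let H := (powMonoidHom (2 ^ (k+1)) : G →* G).ker
    let f : H →* G := (powMonoidHom 2).comp H.subtype
    have h1 : Nat.card f.ker ≤ 2 := by
      refine le_trans (Nat.card_le_card_of_injective
        (fun x : f.ker => (⟨(x : H), by
          exact x.2⟩ : (powMonoidHom 2 : G →* G).ker)) ?_) h
      intro x y hxy
      have h := Subtype.ext_iff.1 hxy
      exact Subtype.ext (Subtype.ext h)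
    have h2 : Nat.card f.range ≤ 2 ^ k := by
      refine le_trans (Nat.card_mono (Set.toFinite _) ?_) ih
      rintro y ⟨x, rfl⟩
      have := x.2
      simp only [H, MonoidHom.mem_ker, powMonoidHom_apply, SetLike.mem_coe, f,
        MonoidHom.comp_apply, Subgroup.subtype_apply] at this ⊢
      rw [← pow_mul, ← this]; ring_nf
    have h3 : Nat.card f.range * Nat.card f.ker = Nat.card H := by
      rw [← Subgroup.index_ker, Subgroup.index_mul_card]
    calc Nat.card H = _ := h3.symm
      _ ≤ 2 ^ k * 2 := Nat.mul_le_mul h2 h1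
      _ = _ := by ring

lemma A_sylow {G : Type*} [CommGroup G] [Finite G]
    (h : Nat.card (powMonoidHom 2 : G →* G).ker ≤ 2) (P : Sylow 2 G) : IsCyclic P := by
  classical
  have hP : Nat.card (powMonoidHom 2 : P →* P).ker ≤ 2 := by
    refine le_trans (Nat.card_le_card_of_injective
        (fun x : (powMonoidHom 2 : P →* P).ker => (⟨((x : P) : G), by
          exact congrArg Subtype.val (MonoidHom.mem_ker.1 x.2)⟩ :
            (powMonoidHom 2 : G →* G).ker)) ?_) h
    intro x y hxy
    have h := Subtype.ext_iff.1 hxy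
    exact Subtype.ext (Subtype.ext h)
  have := Fintype.ofFinite P
  refine isCyclic_of_card_pow_eq_one_le fun n hn => ?_
  obtain ⟨k, m, hm, rfl⟩ := Nat.exists_eq_two_pow_mul_odd hn.ne'
  have h1 : (Finset.univ.filter fun a : P => a ^ (2 ^ k * m) = 1).card
      ≤ Nat.card (powMonoidHom (2 ^ k) : P →* P).ker := by
    have e := Nat.card_eq_card_toFinset ((powMonoidHom (2 ^ k) : P →* P).ker : Set P)
    refine le_trans ?_ e.ge
    refine Finset.card_le_card ?_
    intro x hx
    simp only [Finset.mem_filter, Finset.mem_univ, true_and] at hx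
    simp only [Set.mem_toFinset, SetLike.mem_coe, MonoidHom.mem_ker, powMonoidHom_apply]
    obtain ⟨j, hj⟩ := P.isPGroup' x
    rw [← orderOf_dvd_iff_pow_eq_one] at hx hj ⊢
    refine Nat.Coprime.dvd_of_dvd_mul_right ?_ hx
    exact Nat.Coprime.coprime_dvd_left hj (Nat.Coprime.pow_left _ ((Nat.coprime_two_left).2 hm))
  refine h1.trans ((A_card_ker hP k).trans ?_)
  exact Nat.le_mul_of_pos_right _ hm.pos

lemma A_nontriv {G : Type*} [CommGroup G] [Finite G] (h : Even (Nat.card G)) (P : Sylow 2 G) :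
    Nontrivial P := by
  have : Fact (Nat.Prime 2) := ⟨Nat.prime_two⟩
  have h2 := P.dvd_card_of_dvd_card h.two_dvd
  exact Finite.one_lt_card_iff_nontrivial.1
    (lt_of_lt_of_le one_lt_two (Nat.le_of_dvd Nat.card_pos h2))
end

section

section
variable (K : Type*) [Field K] [NumberField K] [IsCyclotomicExtension {8} ℚ K]

lemma B_cyc : IsCyclotomicExtension {2 ^ (2 + 1)} ℚ K :=
  inferInstanceAs (IsCyclotomicExtension {8} ℚ K)

lemma B_finrank : Module.finrank ℚ K = 4 := by
  rw [IsCyclotomicExtension.Rat.finrank 8 K]; decide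

lemma B_complex : InfinitePlace.nrComplexPlaces K = 2 := by
  rw [IsCyclotomicExtension.Rat.nrComplexPlaces_eq_totient_div_two 8]; decide

lemma B_real : InfinitePlace.nrRealPlaces K = 0 :=
  IsCyclotomicExtension.Rat.nrRealPlaces_eq_zero (n := 8) K (by norm_num)

lemma B_discr : |discr K| = 256 := by
  have := IsCyclotomicExtension.Rat.natAbs_discr 8 K
  rw [Int.abs_eq_natAbs, this]
  have h : Nat.primeFactors 8 = {2} := by
    rw [show 8 = 2 ^ 3 by norm_num, Nat.primeFactors_prime_pow (by norm_num) Nat.prime_two]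
  rw [h]
  have : Nat.totient 8 = 4 := by decide
  simp [this]

lemma B_prime {ζ : K} (hζ : IsPrimitiveRoot ζ 8) : Prime (hζ.toInteger - 1) := by
  have := B_cyc K
  have : Fact (Nat.Prime 2) := ⟨Nat.prime_two⟩
  exact IsPrimitiveRoot.zeta_sub_one_prime (p := 2) (k := 2) hζ

lemma B_pid : IsPrincipalIdealRing (𝓞 K) := by
  have hζ := IsCyclotomicExtension.zeta_spec 8 ℚ K
  refine RingOfIntegers.isPrincipalIdealRing_of_isPrincipal_of_norm_le fun I hI => ?_
  rw [B_finrank, B_complex, ← Int.cast_abs, B_discr] at hI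
  have h3 : (Ideal.absNorm (I : Ideal (𝓞 K)) : ℝ) < 3 := by
    refine hI.trans_lt ?_
    have hs : √((256 : ℤ) : ℝ) = 16 := by
      rw [show ((256 : ℤ) : ℝ) = 16 ^ 2 by norm_num, Real.sqrt_sq (by norm_num)]
    rw [hs]
    have hpi := Real.pi_gt_three
    have h4 : 4 / Real.pi < 4 / 3 := by gcongr
    have h5 : (4 / Real.pi) ^ 2 < (4 / 3) ^ 2 := by
      gcongr
    have : ((Nat.factorial 4 : ℕ) : ℝ) = 24 := by norm_num [Nat.factorial]
    rw [this]
    norm_num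
    norm_num at h5
    linarith
  have h3' : Ideal.absNorm (I : Ideal (𝓞 K)) < 3 := by exact_mod_cast h3
  have h0 : 0 < Ideal.absNorm (I : Ideal (𝓞 K)) := Ideal.absNorm_pos_of_nonZeroDivisors I
  obtain h1 | h2 : Ideal.absNorm (I : Ideal (𝓞 K)) = 1 ∨ Ideal.absNorm (I : Ideal (𝓞 K)) = 2 := by
    omega
  · rw [Ideal.absNorm_eq_one_iff.1 h1]; exact top_isPrincipal
  · have hp := B_prime K hζ
    have hmax : (Ideal.span {hζ.toInteger - 1}).IsMaximal :=
      ((Ideal.span_singleton_prime hp.ne_zero).2 hp).isMaximal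
        (by simpa using hp.ne_zero)
    have hmem : hζ.toInteger - 1 ∈ (I : Ideal (𝓞 K)) := by
      rw [← Ideal.Quotient.eq_zero_iff_mem, map_sub, map_one]
      have hc : Nat.card (𝓞 K ⧸ (I : Ideal (𝓞 K))) = 2 := by
        rw [← h2, Ideal.absNorm_apply, Submodule.cardQuot_apply]
      have hu : IsUnit (Ideal.Quotient.mk (I : Ideal (𝓞 K)) hζ.toInteger) :=
        (hζ.toInteger_isPrimitiveRoot.isUnit (by norm_num)).map _
      have : Nontrivial (𝓞 K ⧸ (I : Ideal (𝓞 K))) := by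
        have : Finite (𝓞 K ⧸ (I : Ideal (𝓞 K))) := Nat.finite_of_card_ne_zero (by omega)
        exact Finite.one_lt_card_iff_nontrivial.1 (by omega)
      obtain ⟨x, y, hxy, hall⟩ := Nat.card_eq_two_iff.1 hc
      have h01 : (0 : 𝓞 K ⧸ (I : Ideal (𝓞 K))) ≠ 1 := zero_ne_one
      have hz0 := hu.ne_zero
      have mem := fun z : 𝓞 K ⧸ (I : Ideal (𝓞 K)) =>
        (Set.ext_iff.1 hall z).2 (Set.mem_univ z)
      simp only [Set.mem_insert_iff, Set.mem_singleton_iff] at mem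
      rw [sub_eq_zero]
      rcases mem 0 with h | h <;> rcases mem 1 with h' | h' <;>
        rcases mem (Ideal.Quotient.mk (I : Ideal (𝓞 K)) hζ.toInteger) with h'' | h'' <;>
        simp_all
    have hne : (I : Ideal (𝓞 K)) ≠ ⊤ := by
      intro h; rw [h] at h2; simp at h2
    have := hmax.eq_of_le hne ((Ideal.span_singleton_le_iff_mem _).2 hmem)
    rw [← this]
    exact ⟨_, rfl⟩
end
end

section
open NumberField.Units

section
variable (F : Type*) [Field F] [NumberField F]

lemma C_card : Nat.card ((𝓞 F)ˣ ⧸ (powMonoidHom 2 : (𝓞 F)ˣ →* (𝓞 F)ˣ).range)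
    = 2 ^ (rank F + 1) := by
  classical
  obtain ⟨g, hg⟩ := IsCyclic.exists_generator (α := torsion F)
  have hgsq : ∀ t : torsion F, t ^ 2 ≠ g := by
    intro t ht
    have hsurj : Function.Surjective (fun x : torsion F => x ^ 2) := by
      intro x
      obtain ⟨k, rfl⟩ := hg x
      refine ⟨t ^ k, ?_⟩
      simp only
      rw [← ht, ← zpow_natCast, ← zpow_natCast, ← zpow_mul, ← zpow_mul, mul_comm]
    have hinj := Finite.injective_iff_surjective.2 hsurj
    have hm : (-1 : (𝓞 F)ˣ) ∈ torsion F := by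
      refine isOfFinOrder_iff_pow_eq_one.2 ?_
      exact ⟨2, by norm_num, by simp⟩
    have h1 : (⟨-1, hm⟩ : torsion F) = 1 := hinj (by ext; simp)
    have h2 := congrArg (fun x : torsion F => ((x : (𝓞 F)ˣ) : F)) h1
    simp only [Units.val_neg, Units.val_one, OneMemClass.coe_one, map_neg, map_one] at h2
    have : (2 : F) = 0 := by linear_combination -h2
    exact two_ne_zero this
  let R : Fin 2 × (Fin (rank F) → Fin 2) → (𝓞 F)ˣ := fun x =>
    ((g ^ (x.1 : ℕ) : torsion F) : (𝓞 F)ˣ) * ∏ i, fundSystem F i ^ ((x.2 i : ℕ) : ℤ)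
  have hb : Function.Bijective (fun x =>
      (QuotientGroup.mk (R x) : (𝓞 F)ˣ ⧸ (powMonoidHom 2 : (𝓞 F)ˣ →* (𝓞 F)ˣ).range)) := by
    constructor
    · rintro ⟨a, e⟩ ⟨a', e'⟩ h
      simp only at h
      rw [QuotientGroup.eq] at h
      obtain ⟨y, hy⟩ := h
      obtain ⟨⟨t, m⟩, htm, -⟩ := exist_unique_eq_mul_prod F y
      have hy' : R (a', e') = R (a, e) * y ^ 2 := by
        simp only [powMonoidHom_apply] at hy; rw [hy]; simp
      obtain ⟨z, -, huniq⟩ := exist_unique_eq_mul_prod F (R (a', e'))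
      have e1 := huniq (g ^ (a' : ℕ), fun i => ((e' i : ℕ) : ℤ)) rfl
      have e2 := huniq (g ^ (a : ℕ) * t ^ 2, fun i => ((e i : ℕ) : ℤ) + 2 * m i) (by
        rw [hy', htm]
        simp only [R, zpow_add, Finset.prod_mul_distrib, Subgroup.coe_mul,
          Subgroup.coe_pow, mul_pow, ← Finset.prod_pow]
        rw [mul_mul_mul_comm]
        congr 2
        refine Finset.prod_congr rfl fun i _ => ?_
        rw [mul_comm 2, zpow_mul]; norm_cast)
      have e3 := e1.trans e2.symm
      rw [Prod.mk.injEq] at e3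
      obtain ⟨e4, e5⟩ := e3
      have ee : e = e' := by
        funext i
        have := congrFun e5 i
        have h1 := (e i).2
        have h2 := (e' i).2
        ext
        omega
      have ea : a = a' := by
        fin_cases a <;> fin_cases a' <;> simp at e4 ⊢
        · exact hgsq t e4.symm
        · refine hgsq t⁻¹ ?_
          rw [inv_pow]
          exact (eq_inv_of_mul_eq_one_left e4.symm).symm
      rw [ee, ea]
    · intro q
      obtain ⟨x, rfl⟩ := QuotientGroup.mk_surjective q
      obtain ⟨⟨t, n⟩, hx, -⟩ := exist_unique_eq_mul_prod F x
      obtain ⟨b, hb⟩ := hg t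
      have key : ∀ n : ℤ, ∃ a : Fin 2, ∃ m : ℤ, n = ((a : ℕ) : ℤ) + m * 2 := by
        intro n
        refine ⟨⟨(n % 2).toNat, by omega⟩, n / 2, ?_⟩
        simp only
        omega
      obtain ⟨a, b', hab⟩ := key b
      choose e m hem using fun i => key (n i)
      refine ⟨(a, e), ?_⟩
      simp only
      rw [QuotientGroup.eq]
      refine ⟨((g ^ b' : torsion F) : (𝓞 F)ˣ) * ∏ i, fundSystem F i ^ m i, ?_⟩
      rw [eq_inv_mul_iff_mul_eq, hx, ← hb]
      simp only [R, powMonoidHom_apply, mul_pow, ← Finset.prod_pow]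
      rw [mul_mul_mul_comm, ← Finset.prod_mul_distrib]
      congr 1
      · rw [← Subgroup.coe_pow, ← Subgroup.coe_mul]
        rw [hab, zpow_add, zpow_mul]; norm_cast
      · refine Finset.prod_congr rfl fun i _ => ?_
        rw [hem i, zpow_add, zpow_mul]; norm_cast
  rw [← Nat.card_congr (Equiv.ofBijective _ hb)]
  simp [pow_succ, mul_comm]
end
end

section

section
variable (K : Type*) [Field K] [NumberField K] [IsCyclotomicExtension {8} ℚ K]

lemma D_adjoin {ζ : K} (hζ : IsPrimitiveRoot ζ 8) :
    Algebra.adjoin ℤ {hζ.toInteger} = ⊤ := by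
  have := hζ.integralPowerBasis.adjoin_gen_eq_top
  rwa [hζ.integralPowerBasis_gen] at this

lemma D_frob {p : ℕ} (hp : p.Prime) (hp8 : p % 8 = 7) (y : 𝓞 K) :
    (p : 𝓞 K) ∣ y ^ (p ^ 2) - y := by
  have hζ := IsCyclotomicExtension.zeta_spec 8 ℚ K
  have : Fact p.Prime := ⟨hp⟩
  let A := 𝓞 K ⧸ Ideal.span {(p : 𝓞 K)}
  by_cases hA : Subsingleton A
  · have : (1 : 𝓞 K) ∈ Ideal.span {(p : 𝓞 K)} := by
      rw [← Ideal.Quotient.eq_zero_iff_mem]; exact Subsingleton.elim _ _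
    rw [Ideal.mem_span_singleton] at this
    exact this.trans (one_dvd _)
  have : Nontrivial A := not_subsingleton_iff_nontrivial.1 hA
  have hc : CharP A p := by
    refine (CharP.charP_iff_prime_eq_zero hp).2 ?_
    have : (Ideal.Quotient.mk (Ideal.span {(p : 𝓞 K)})) (p : 𝓞 K) = 0 :=
      Ideal.Quotient.eq_zero_iff_mem.2 (Ideal.mem_span_singleton_self _)
    simpa using this
  let f : 𝓞 K →ₐ[ℤ] A := (Ideal.Quotient.mk (Ideal.span {(p : 𝓞 K)})).toIntAlgHom
  let g : 𝓞 K →ₐ[ℤ] A :=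
    ((iterateFrobenius A p 2).comp (Ideal.Quotient.mk (Ideal.span {(p : 𝓞 K)}))).toIntAlgHom
  have hfg : g = f := by
    refine AlgHom.ext_of_adjoin_eq_top (D_adjoin K hζ) ?_
    intro x hx
    rw [Set.mem_singleton_iff.1 hx]
    change (iterateFrobenius A p 2) (Ideal.Quotient.mk _ hζ.toInteger) = Ideal.Quotient.mk _ _
    rw [iterateFrobenius_def, ← map_pow]
    congr 1
    have h8 : p ^ 2 % 8 = 1 := by rw [Nat.pow_mod, hp8]
    rw [← Nat.div_add_mod (p ^ 2) 8, h8, pow_add, pow_mul,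
      hζ.toInteger_isPrimitiveRoot.pow_eq_one]
    simp
  have h := DFunLike.congr_fun hfg y
  change (iterateFrobenius A p 2) (Ideal.Quotient.mk _ y) = Ideal.Quotient.mk _ y at h
  rw [iterateFrobenius_def, ← map_pow] at h
  rw [← Ideal.mem_span_singleton]
  exact Ideal.Quotient.eq.1 h

lemma D_not_unit {p : ℕ} (hp : p.Prime) : ¬ IsUnit (p : 𝓞 K) := by
  intro h
  have h2 := h.map (Algebra.norm ℤ)
  rw [show (p : 𝓞 K) = algebraMap ℤ (𝓞 K) p by simp, Algebra.norm_algebraMap] at h2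
  rw [isUnit_pow_iff (by rw [RingOfIntegers.rank, B_finrank K]; norm_num)] at h2
  exact (Nat.prime_iff_prime_int.1 hp).not_isUnit h2

lemma D_nsq {p : ℕ} (hp : p.Prime) (hp8 : p % 8 = 7) (y : K) : y ^ 2 ≠ p := by
  intro h
  have h_int : IsIntegral ℤ y := by
    refine IsIntegral.of_pow (n := 2) (by norm_num) ?_
    rw [h]; exact isIntegral_natCast p
  obtain ⟨z, rfl⟩ : ∃ z : 𝓞 K, (z : K) = y := ⟨⟨y, h_int⟩, rfl⟩
  have hz : z ^ 2 = p := by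
    apply RingOfIntegers.coe_injective; simpa using h
  have h1 := D_frob K hp hp8 z
  have h2 : (p : 𝓞 K) ∣ z ^ (p ^ 2) := by
    rw [← hz]; exact pow_dvd_pow _ (by nlinarith [hp.two_le])
  have h3 : (p : 𝓞 K) ∣ z := by
    have := dvd_sub h2 h1
    simpa using this
  obtain ⟨w, rfl⟩ := h3
  have hp0 : (p : 𝓞 K) ≠ 0 := by exact_mod_cast hp.ne_zero
  refine D_not_unit K hp (IsUnit.of_mul_eq_one (w ^ 2) ?_)
  apply mul_left_cancel₀ hp0
  linear_combination hz
end

section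
variable {L : Type} [Field L] [NumberField L]

lemma D_normal {p : ℕ} {ζ s : L} (hζ : IsPrimitiveRoot ζ 8) (hs : s ^ 2 = (p : L))
    (hgen : Algebra.adjoin ℚ {ζ, s} = ⊤) : IsGalois ℚ L := by
  have hn : Normal ℚ L := by
    have h1 : (⊤ : IntermediateField ℚ L) = IntermediateField.adjoin ℚ {ζ, s} := by
      symm
      rw [eq_top_iff]
      intro x _
      have : x ∈ Algebra.adjoin ℚ {ζ, s} := hgen ▸ Algebra.mem_top
      exact IntermediateField.algebra_adjoin_le_adjoin _ _ this
    let q : Polynomial ℚ := (Polynomial.X ^ 8 - 1) * (Polynomial.X ^ 2 - Polynomial.C (p : ℚ))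
    have hq0 : q ≠ 0 := mul_ne_zero (Polynomial.X_pow_sub_C_ne_zero (by norm_num) 1)
        (Polynomial.X_pow_sub_C_ne_zero (by norm_num) _)
    have : q.IsSplittingField ℚ L := by
      constructor
      · simp only [q, Polynomial.map_mul, Polynomial.map_sub, Polynomial.map_pow,
          Polynomial.map_X, Polynomial.map_one, Polynomial.map_C]
        refine Polynomial.Splits.mul ?_ ?_
        · simpa using Polynomial.X_pow_sub_one_splits hζ
        · have : (Polynomial.X ^ 2 - Polynomial.C ((algebraMap ℚ L) (p : ℚ)) : Polynomial L)
            = (Polynomial.X - Polynomial.C s) * (Polynomial.X - Polynomial.C (-s)) := by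
            rw [map_natCast, ← hs]; simp; ring
          rw [this]
          exact (Polynomial.Splits.X_sub_C _).mul (Polynomial.Splits.X_sub_C _)
      · rw [eq_top_iff, ← hgen]
        refine Algebra.adjoin_mono ?_
        intro x hx
        rw [Polynomial.mem_rootSet]
        refine ⟨hq0, ?_⟩
        rcases hx with rfl | rfl
        · simp [q, hζ.pow_eq_one]
        · simp [q, hs]
    exact Normal.of_isSplittingField q
  exact { }

lemma D_aut {p : ℕ} (hp : p.Prime) (hp8 : p % 8 = 7) {ζ s : L} (hζ : IsPrimitiveRoot ζ 8)
    (hs : s ^ 2 = (p : L)) (hgen : Algebra.adjoin ℚ {ζ, s} = ⊤) :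
    ∃ σ : L ≃ₐ[IntermediateField.adjoin ℚ {ζ}] L, ∃ τ κ : L ≃ₐ[ℚ] L,
      σ s = - s ∧ τ ζ = - ζ ∧ τ s = s ∧ κ ζ = ζ⁻¹ ∧ κ s = s := by
  have hG := D_normal hζ hs hgen
  let K := IntermediateField.adjoin ℚ {ζ}
  have : IsCyclotomicExtension {8} ℚ K := hζ.intermediateField_adjoin_isCyclotomicExtension ℚ
  have hs' : ∀ f : L →+* L, f s = s ∨ f s = - s := by
    intro f
    rw [← sq_eq_sq_iff_eq_or_eq_neg, ← map_pow, hs, map_natCast]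
  have hsK : s ∉ Set.range (algebraMap K L) := by
    rintro ⟨y, hy⟩
    refine D_nsq K hp hp8 y ?_
    apply (algebraMap K L).injective
    rw [map_pow, hy, hs, map_natCast]
  obtain ⟨σ, hσ⟩ : ∃ σ : L ≃ₐ[K] L, σ s = - s := by
    rw [← Algebra.coe_bot (R := K) (A := L)] at hsK
    have h : ¬ ∀ f : L ≃ₐ[K] L, f s = s := fun h => hsK ((IsGalois.mem_bot_iff_fixed s).2 h)
    push Not at h
    obtain ⟨σ, h⟩ := h
    exact ⟨σ, (hs' (σ : L →+* L)).resolve_left h⟩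
  have hσζ : σ ζ = ζ := σ.commutes ⟨ζ, IntermediateField.mem_adjoin_simple_self ℚ ζ⟩
  have key : ∀ ξ : L, IsPrimitiveRoot ξ 8 → ∃ f : L ≃ₐ[ℚ] L, f ζ = ξ ∧ f s = s := by
    intro ξ hξ
    have hc : IsConjRoot ℚ ζ ξ := by
      rw [isConjRoot_def, ← Polynomial.cyclotomic_eq_minpoly_rat hζ (by norm_num),
        ← Polynomial.cyclotomic_eq_minpoly_rat hξ (by norm_num)]
    obtain ⟨f, hf⟩ := isConjRoot_iff_exists_algEquiv.1 hc.symm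
    rcases hs' (f : L →+* L) with h | h
    · exact ⟨f, hf, h⟩
    · refine ⟨(σ.restrictScalars ℚ).trans f, ?_, ?_⟩
      · simp [hσζ, hf]
      · have h : f s = - s := h
        simp [hσ, h]
  obtain ⟨τ, h1, h2⟩ := key (-ζ) (by
    have h4 : ζ ^ 4 = -1 := by
      have : ζ ^ 4 ≠ 1 := hζ.pow_ne_one_of_pos_of_lt (by norm_num) (by norm_num)
      have h8 := hζ.pow_eq_one
      have : (ζ ^ 4 - 1) * (ζ ^ 4 + 1) = 0 := by linear_combination h8
      rcases mul_eq_zero.1 this with h | h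
      · exact absurd (sub_eq_zero.1 h) (by assumption)
      · linear_combination h
    have : -ζ = ζ ^ 5 := by linear_combination -ζ * h4
    rw [this]
    exact hζ.pow_of_coprime 5 (by norm_num))
  obtain ⟨κ, h3, h4⟩ := key ζ⁻¹ hζ.inv
  exact ⟨σ, τ, κ, hσ, h1, h2, h3, h4⟩

end
end

section

/-- The field `ℚ(ζ₈, √p)` with its three generating automorphisms. -/
structure Dat (p : ℕ) (L : Type) [Field L] [NumberField L] where
  hp : p.Prime
  hp8 : p % 8 = 7
  ζ : L
  s : L
  hζ : IsPrimitiveRoot ζ 8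
  hs : s ^ 2 = (p : L)
  hgen : Algebra.adjoin ℚ {ζ, s} = ⊤
  σ : L ≃ₐ[IntermediateField.adjoin ℚ {ζ}] L
  τ : L ≃ₐ[ℚ] L
  κ : L ≃ₐ[ℚ] L
  hσs : σ s = - s
  hτζ : τ ζ = - ζ
  hτs : τ s = s
  hκζ : κ ζ = ζ⁻¹
  hκs : κ s = s

namespace Dat
variable {p : ℕ} {L : Type} [Field L] [NumberField L] (D : Dat p L)

lemma hσζ : D.σ D.ζ = D.ζ :=
  D.σ.commutes ⟨D.ζ, IntermediateField.mem_adjoin_simple_self ℚ D.ζ⟩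

lemma z4 : D.ζ ^ 4 = -1 := by
  have : D.ζ ^ 4 ≠ 1 := D.hζ.pow_ne_one_of_pos_of_lt (by norm_num) (by norm_num)
  have h8 := D.hζ.pow_eq_one
  have : (D.ζ ^ 4 - 1) * (D.ζ ^ 4 + 1) = 0 := by linear_combination h8
  rcases mul_eq_zero.1 this with h | h
  · exact absurd (sub_eq_zero.1 h) (by assumption)
  · linear_combination h

lemma zne : D.ζ ≠ 0 := D.hζ.ne_zero (by norm_num)

lemma hκζ' : D.κ D.ζ = - D.ζ ^ 3 := by
  rw [D.hκζ]
  refine inv_eq_of_mul_eq_one_right ?_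
  linear_combination -D.z4

lemma sne : D.s ≠ 0 := by
  intro h
  have := D.hs
  rw [h] at this
  have h2 : (p : L) = 0 := by rw [← this]; ring
  exact D.hp.ne_zero (by exact_mod_cast h2)

lemma ext {R : Type*} [Semiring R] [Algebra ℚ R] (f g : L →ₐ[ℚ] R) (h1 : f D.ζ = g D.ζ)
    (h2 : f D.s = g D.s) : f = g := by
  refine AlgHom.ext_of_adjoin_eq_top D.hgen ?_
  rintro x (rfl | rfl)
  · exact h1
  · exact h2

/-- `σ` as a rational automorphism -/
def σ0 : L →ₐ[ℚ] L := (D.σ.restrictScalars ℚ : L ≃ₐ[ℚ] L)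
def τ0 : L →ₐ[ℚ] L := D.τ
def κ0 : L →ₐ[ℚ] L := D.κ

lemma στ (x : L) : D.σ (D.τ x) = D.τ (D.σ x) := by
  refine DFunLike.congr_fun (D.ext (D.σ0.comp D.τ0) (D.τ0.comp D.σ0) ?_ ?_) x
  · change D.σ (D.τ _) = D.τ (D.σ _)
    simp [D.hσζ, D.hτζ]
  · change D.σ (D.τ _) = D.τ (D.σ _)
    simp [D.hσs, D.hτs]

lemma σκ (x : L) : D.σ (D.κ x) = D.κ (D.σ x) := by
  refine DFunLike.congr_fun (D.ext (D.σ0.comp D.κ0) (D.κ0.comp D.σ0) ?_ ?_) x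
  · change D.σ (D.κ _) = D.κ (D.σ _)
    simp [D.hσζ, D.hκζ]
  · change D.σ (D.κ _) = D.κ (D.σ _)
    simp [D.hσs, D.hκs]

lemma τκ (x : L) : D.τ (D.κ x) = D.κ (D.τ x) := by
  refine DFunLike.congr_fun (D.ext (D.τ0.comp D.κ0) (D.κ0.comp D.τ0) ?_ ?_) x
  · change D.τ (D.κ _) = D.κ (D.τ _)
    simp only [D.hκζ, D.hτζ, map_inv₀, map_neg, inv_neg]
  · change D.τ (D.κ _) = D.κ (D.τ _)
    simp [D.hτs, D.hκs]

lemma ττ (x : L) : D.τ (D.τ x) = x := by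
  refine DFunLike.congr_fun (D.ext (D.τ0.comp D.τ0) (AlgHom.id ℚ L) ?_ ?_) x
  · change D.τ (D.τ _) = _
    simp [D.hτζ]
  · change D.τ (D.τ _) = _
    simp [D.hτs]

lemma σσ (x : L) : D.σ (D.σ x) = x := by
  refine DFunLike.congr_fun (D.ext (D.σ0.comp D.σ0) (AlgHom.id ℚ L) ?_ ?_) x
  · change D.σ (D.σ _) = _
    simp [D.hσζ]
  · change D.σ (D.σ _) = _
    simp [D.hσs]

lemma fixed {x : L} (hx : D.σ x = x) : ∃ y : IntermediateField.adjoin ℚ {D.ζ}, (y : L) = x := by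
  have := D_normal D.hζ D.hs D.hgen
  have h := (IsGalois.mem_bot_iff_fixed (F := IntermediateField.adjoin ℚ {D.ζ}) x).2 (by
    intro f
    have hfζ : f D.ζ = D.ζ :=
      f.commutes ⟨D.ζ, IntermediateField.mem_adjoin_simple_self ℚ D.ζ⟩
    have hf : f D.s = D.s ∨ f D.s = - D.s := by
      rw [← sq_eq_sq_iff_eq_or_eq_neg, ← map_pow, D.hs, map_natCast]
    rcases hf with hf | hf
    · exact DFunLike.congr_fun (D.ext ((f.restrictScalars ℚ : L ≃ₐ[ℚ] L) : L →ₐ[ℚ] L)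
        (AlgHom.id ℚ L) hfζ hf) x
    · have := DFunLike.congr_fun (D.ext ((f.restrictScalars ℚ : L ≃ₐ[ℚ] L) : L →ₐ[ℚ] L)
        D.σ0 (hfζ.trans D.hσζ.symm) (hf.trans D.hσs.symm)) x
      exact this.trans hx)
  rw [← IntermediateField.mem_toSubalgebra, IntermediateField.bot_toSubalgebra,
    Algebra.mem_bot] at h
  exact h

lemma cyc : IsCyclotomicExtension {8} ℚ (IntermediateField.adjoin ℚ {D.ζ}) :=
  D.hζ.intermediateField_adjoin_isCyclotomicExtension ℚ

lemma fixed_int {x : L} (hx : D.σ x = x) (hi : IsIntegral ℤ x) :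
    x ∈ Algebra.adjoin ℤ {D.ζ} := by
  obtain ⟨y, rfl⟩ := D.fixed hx
  have := D.cyc
  let K := IntermediateField.adjoin ℚ {D.ζ}
  have hy : IsIntegral ℤ y := (isIntegral_algebraMap_iff (algebraMap K L).injective).1 hi
  let z : 𝓞 K := ⟨y, hy⟩
  have hζK : IsPrimitiveRoot (⟨D.ζ, IntermediateField.mem_adjoin_simple_self ℚ D.ζ⟩ : K) 8 :=
    IsPrimitiveRoot.of_map_of_injective (f := algebraMap K L) D.hζ (algebraMap K L).injective
  have hz : z ∈ Algebra.adjoin ℤ {hζK.toInteger} := by rw [D_adjoin K hζK]; trivial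
  let f : 𝓞 K →ₐ[ℤ] L := ((algebraMap K L).comp (algebraMap (𝓞 K) K)).toIntAlgHom
  have h2 : f z ∈ (Algebra.adjoin ℤ {hζK.toInteger}).map f := ⟨z, hz, rfl⟩
  rw [AlgHom.map_adjoin, Set.image_singleton] at h2
  exact h2

lemma ζ_nsq (x : L) : x ^ 2 ≠ D.ζ := by
  intro h
  have h1 : (D.τ x) ^ 2 = (D.ζ ^ 2 * x) ^ 2 := by
    rw [← map_pow, h, D.hτζ, mul_pow, h]; linear_combination - D.ζ * D.z4
  have h2 : D.τ (D.τ x) = - x := by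
    rcases sq_eq_sq_iff_eq_or_eq_neg.1 h1 with h | h <;>
    · rw [h]; simp only [map_neg, map_mul, map_pow, D.hτζ, h]; linear_combination x * D.z4
  rw [D.ττ] at h2
  have : (2 : L) * x = 0 := by linear_combination h2
  have hx : x = 0 := by simpa using this
  rw [hx] at h
  exact D.zne (by rw [← h]; ring)

lemma pow8 (D : Dat p L) (k : ℕ) (y : L) (h : y ^ (2 ^ k) = 1) : y ^ 8 = 1 := by
  induction k generalizing y with
  | zero => simp at h; simp [h]
  | succ k ih =>
    have h1 := ih (y ^ 2) (by rw [← pow_mul, ← h]; ring_nf)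
    obtain ⟨j, -, hj⟩ := IsPrimitiveRoot.eq_pow_of_pow_eq_one (k := 8) D.hζ h1
    rcases Nat.even_or_odd' j with ⟨i, rfl | rfl⟩
    · have h2 : y ^ 2 = (D.ζ ^ i) ^ 2 := by rw [← hj]; ring
      have h8 : (D.ζ ^ i) ^ 8 = 1 := by rw [← pow_mul, mul_comm, pow_mul, D.hζ.pow_eq_one, one_pow]
      calc y ^ 8 = (y ^ 2) ^ 4 := by ring
        _ = (D.ζ ^ i) ^ 8 := by rw [h2]; ring
        _ = 1 := h8
    · exfalso
      refine D.ζ_nsq (y / D.ζ ^ i) ?_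
      have := pow_ne_zero i D.zne
      rw [div_pow, ← hj]; field_simp; ring

lemma root {u : L} (hu0 : u ≠ 0) (hi : IsIntegral ℤ u) (hi' : IsIntegral ℤ u⁻¹) :
    ∃ m : ℕ, Odd m ∧ ∃ j : ℕ, (u / D.κ u) ^ m = D.ζ ^ j := by
  have h_int : IsIntegral ℤ (u / D.κ u) := by
    rw [div_eq_mul_inv, ← map_inv₀]
    exact hi.mul (hi'.map ((D.κ : L →ₐ[ℚ] L).restrictScalars ℤ))
  have hκ : ∀ φ : L →+* ℂ, ∀ x, φ (D.κ x) = (starRingEnd ℂ) (φ x) := by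
    intro φ x
    refine DFunLike.congr_fun (D.ext (φ.toRatAlgHom.comp D.κ0)
      ((starRingEnd ℂ).comp φ).toRatAlgHom ?_ ?_) x
    · change φ (D.κ D.ζ) = (starRingEnd ℂ) (φ D.ζ)
      rw [D.hκζ, map_inv₀]
      refine (Complex.inv_eq_conj ?_)
      exact (D.hζ.map_of_injective φ.injective).norm'_eq_one (by norm_num)
    · change φ (D.κ D.s) = (starRingEnd ℂ) (φ D.s)
      rw [D.hκs]
      symm
      rw [Complex.conj_eq_iff_im]
      have h := congrArg φ D.hs
      rw [map_pow, map_natCast] at h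
      have him := congrArg Complex.im h
      have hre := congrArg Complex.re h
      simp [pow_two] at him hre
      have hp := D.hp.pos
      by_contra hne
      have h0 : (φ D.s).re = 0 := by
        have : (φ D.s).re * (φ D.s).im = 0 := by linarith
        exact (mul_eq_zero.1 this).resolve_right hne
      rw [h0] at hre
      have : (0 : ℝ) < p := by exact_mod_cast hp
      nlinarith [mul_self_nonneg (φ D.s).im]
  obtain ⟨n, hn, hn1⟩ := Embeddings.pow_eq_one_of_norm_eq_one L ℂ h_int (by
    intro φ
    rw [map_div₀, hκ, norm_div, Complex.norm_conj, div_self]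
    simpa using hu0)
  obtain ⟨k, m, hm, rfl⟩ := Nat.exists_eq_two_pow_mul_odd (n := n) (by omega)
  refine ⟨m, hm, ?_⟩
  have h8 := D.pow8 k ((u / D.κ u) ^ m) (by rw [← pow_mul, mul_comm, hn1])
  obtain ⟨j, -, hj⟩ := IsPrimitiveRoot.eq_pow_of_pow_eq_one (k := 8) D.hζ h8
  exact ⟨j, hj.symm⟩

end Dat
end

section

namespace Dat
variable {p : ℕ} {L : Type} [Field L] [NumberField L] (D : Dat p L)

lemma half_not (L : Type) [Field L] [NumberField L] : ¬ IsIntegral ℤ ((2 : L)⁻¹) := by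
  intro h
  have h1 : IsIntegral ℤ (algebraMap ℚ L (2 : ℚ)⁻¹) := by simpa using h
  rw [isIntegral_algebraMap_iff (algebraMap ℚ L).injective, IsIntegrallyClosed.isIntegral_iff] at h1
  obtain ⟨y, hy⟩ := h1
  have h2 : (2 : ℚ) * y = 1 := by
    have : (y : ℚ) = 2⁻¹ := hy
    rw [this]; norm_num
  have h3 : 2 * y = 1 := by exact_mod_cast h2
  omega

lemma zint : IsIntegral ℤ D.ζ := D.hζ.isIntegral (by norm_num)

lemma int_τ {x : L} (h : IsIntegral ℤ x) : IsIntegral ℤ (D.τ x) :=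
  h.map ((D.τ : L →ₐ[ℚ] L).restrictScalars ℤ)
lemma int_κ {x : L} (h : IsIntegral ℤ x) : IsIntegral ℤ (D.κ x) :=
  h.map ((D.κ : L →ₐ[ℚ] L).restrictScalars ℤ)
lemma int_σ {x : L} (h : IsIntegral ℤ x) : IsIntegral ℤ (D.σ x) :=
  h.map ((D.σ0 : L →ₐ[ℚ] L).restrictScalars ℤ)

lemma lam_not : ¬ IsIntegral ℤ (1 - D.ζ)⁻¹ := by
  intro h
  have h1 := D.int_τ h
  rw [map_inv₀, map_sub, D.hτζ, map_one] at h1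
  refine half_not L ?_
  have h2 : (2 : L)⁻¹ = - (D.ζ ^ 2) * ((1 - D.ζ)⁻¹ * (1 - -D.ζ)⁻¹) ^ 2 := by
    have e : (2 : L) = D.ζ ^ 2 * ((1 - D.ζ) * (1 - - D.ζ)) ^ 2 := by
      linear_combination (2 - D.ζ ^ 2) * D.z4
    rw [← mul_inv]
    have : (2 : L)⁻¹ = (D.ζ ^ 2)⁻¹ * (((1 - D.ζ) * (1 - - D.ζ)) ^ 2)⁻¹ := by
      rw [← mul_inv, ← e]
    rw [this, inv_pow]
    congr 1
    refine inv_eq_of_mul_eq_one_right ?_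
    linear_combination - D.z4
  rw [h2]
  exact ((D.zint.pow 2).neg).mul ((h.mul h1).pow 2)

lemma lam_ne : 1 - D.ζ ≠ 0 := by
  intro h
  exact D.hζ.ne_one (by norm_num) (sub_eq_zero.1 h).symm

lemma kap_sub {y : L} (hy : y ∈ Algebra.adjoin ℤ {D.ζ}) :
    ∃ t : L, IsIntegral ℤ t ∧ IsIntegral ℤ y ∧ D.κ y - y = (1 - D.ζ) ^ 2 * t := by
  have hw : IsIntegral ℤ (D.ζ + D.ζ ^ 2 + D.ζ ^ 3) :=
    (D.zint.add (D.zint.pow 2)).add (D.zint.pow 3)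
  induction hy using Algebra.adjoin_induction with
  | mem x hx =>
    obtain rfl : x = D.ζ := hx
    refine ⟨- D.ζ ^ 3 * (D.ζ + D.ζ ^ 2 + D.ζ ^ 3), ((D.zint.pow 3).neg).mul hw, D.zint, ?_⟩
    rw [D.hκζ']
    linear_combination (D.ζ ^ 4 - D.ζ ^ 3 - D.ζ) * D.z4
  | algebraMap r =>
    refine ⟨0, isIntegral_zero, isIntegral_algebraMap, ?_⟩
    simp
  | add x y _ _ hx hy =>
    obtain ⟨t, ht, ix, ex⟩ := hx
    obtain ⟨t', ht', iy, ey⟩ := hy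
    exact ⟨t + t', ht.add ht', ix.add iy, by rw [map_add]; linear_combination ex + ey⟩
  | mul x y _ _ hx hy =>
    obtain ⟨t, ht, ix, ex⟩ := hx
    obtain ⟨t', ht', iy, ey⟩ := hy
    refine ⟨t * D.κ y + x * t', (ht.mul (D.int_κ iy)).add (ix.mul ht'), ix.mul iy, ?_⟩
    rw [map_mul]; linear_combination D.κ y * ex + x * ey

lemma a_even {y : L} (hy0 : y ≠ 0) (hσ : D.σ y = y) (hi : IsIntegral ℤ y) (hi' : IsIntegral ℤ y⁻¹)
    (a : ℕ) (h : y / D.κ y = D.ζ ^ a) : Even a := by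
  by_contra hodd
  rw [Nat.not_even_iff_odd] at hodd
  obtain ⟨t, ht, -, e⟩ := D.kap_sub (D.fixed_int hσ hi)
  have hκ0 : D.κ y ≠ 0 := by simpa using hy0
  have hy : y = D.ζ ^ a * D.κ y := by rw [← h]; field_simp
  have e1 : 1 - D.ζ ^ a = (1 - D.ζ) ^ 2 * (t * D.κ y⁻¹) := by
    rw [map_inv₀]
    field_simp
    linear_combination e + hy
  have hz : D.ζ = (D.ζ ^ a) ^ a := by
    obtain ⟨b, rfl⟩ := hodd
    obtain ⟨c, hc⟩ := Nat.even_mul_succ_self b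
    rw [← pow_mul]
    have : (2 * b + 1) * (2 * b + 1) = 8 * c + 1 := by
      have : 4 * (b * (b + 1)) + 1 = 8 * c + 1 := by rw [hc]; ring
      rw [← this]; ring
    rw [this, pow_add, pow_mul, D.hζ.pow_eq_one]; simp
  have e2 : 1 - D.ζ = (1 - D.ζ ^ a) * ∑ i ∈ Finset.range a, (D.ζ ^ a) ^ i := by
    rw [mul_neg_geom_sum, ← hz]
  set g := ∑ i ∈ Finset.range a, (D.ζ ^ a) ^ i with hg
  have hgi : IsIntegral ℤ g := IsIntegral.sum _ fun i _ => (D.zint.pow a).pow i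
  have hne := D.lam_ne
  have e3 : (1 - D.ζ)⁻¹ = t * D.κ y⁻¹ * g := by
    refine inv_eq_of_mul_eq_one_right ?_
    refine mul_left_cancel₀ hne ?_
    rw [mul_one]
    nth_rewrite 3 [e2]
    rw [e1]; ring
  exact D.lam_not (by rw [e3]; exact (ht.mul (D.int_κ hi')).mul hgi)

lemma low_field {δ : L} (hδ : δ ≠ 0) {h : ℕ} (hh : Odd h)
    (hu : IsIntegral ℤ (D.τ δ / δ)) (hu' : IsIntegral ℤ (D.τ δ / δ)⁻¹)
    (hη : IsIntegral ℤ (δ * D.σ δ / (1 - D.ζ) ^ h))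
    (hη' : IsIntegral ℤ (δ * D.σ δ / (1 - D.ζ) ^ h)⁻¹) : False := by
  set u := D.τ δ / δ with hu_def
  set η := δ * D.σ δ / (1 - D.ζ) ^ h with hη_def
  have hne := D.lam_ne
  have hne' : 1 + D.ζ ≠ 0 := by
    intro h0
    apply hne
    have := congrArg D.τ h0
    rw [map_add, map_one, D.hτζ, map_zero] at this
    linear_combination this
  have hτδ : D.τ δ ≠ 0 := by simpa using hδ
  have hσδ : D.σ δ ≠ 0 := by simpa using hδ
  have hu0 : u ≠ 0 := div_ne_zero hτδ hδ
  have hη0 : η ≠ 0 := div_ne_zero (mul_ne_zero hδ hσδ) (pow_ne_zero _ hne)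
  have hση : D.σ η = η := by
    rw [hη_def, map_div₀, map_mul, D.σσ, map_pow, map_sub, map_one, D.hσζ, mul_comm]
  obtain ⟨m, hm, j, hj⟩ := D.root hu0 hu hu'
  obtain ⟨m', hm', a, ha⟩ := D.root hη0 hη hη'
  have hae : Even a := by
    refine D.a_even (y := η ^ m') (pow_ne_zero _ hη0) (by rw [map_pow, hση]) (hη.pow _)
      (by rw [← inv_pow]; exact hη'.pow _) a ?_
    rw [map_pow, ← div_pow, ha]
  have huτ : u * D.τ u = 1 := by
    rw [hu_def, map_div₀, D.ττ]; field_simp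
  set w := (1 + D.ζ) / (1 - D.ζ) with hw
  have hw0 : w ≠ 0 := div_ne_zero hne' hne
  have hκw : D.κ w = - w := by
    have hz := D.zne
    have h1 : D.ζ - 1 ≠ 0 := by
      intro h0; apply hne; linear_combination - h0
    have h1' : 1 - D.ζ⁻¹ ≠ 0 := by
      intro h0; apply h1; field_simp at h0; simpa using h0
    rw [hw, map_div₀, map_add, map_sub, map_one, D.hκζ, div_eq_iff h1', ← neg_div, div_mul_eq_mul_div, eq_div_iff hne]
    field_simp
    ring
  have huσ : u * D.σ u = w ^ h * (D.τ η / η) := by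
    have e1 : D.τ η = D.τ δ * D.τ (D.σ δ) / (1 + D.ζ) ^ h := by
      rw [hη_def, map_div₀, map_mul, map_pow, map_sub, map_one, D.hτζ, sub_neg_eq_add]
    have e2 : D.σ u = D.τ (D.σ δ) / D.σ δ := by
      rw [hu_def, map_div₀, D.στ]
    rw [e1, e2, hw, hη_def, hu_def, div_pow]
    field_simp
  clear_value u η w
  set ω := u / D.κ u with hω
  set ρ := η / D.κ η with hρ
  have hωτ : ω * D.τ ω = 1 := by
    have e : D.κ u * D.κ (D.τ u) = 1 := by rw [← map_mul, huτ, map_one]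
    rw [hω, map_div₀, D.τκ, div_mul_div_comm, huτ, e, div_one]
  have hκ0 : D.κ η ≠ 0 := by simpa using hη0
  have hτ0 : D.τ η ≠ 0 := by simpa using hη0
  have hκτ0 : D.κ (D.τ η) ≠ 0 := by simpa using hη0
  have hωσ : ω * D.σ ω = - (D.τ ρ / ρ) := by
    have e : D.κ u * D.κ (D.σ u) = - (w ^ h) * (D.κ (D.τ η) / D.κ η) := by
      rw [← map_mul, huσ, map_mul, map_div₀, map_pow, hκw, hh.neg_pow]
    rw [hω, map_div₀, D.σκ, div_mul_div_comm, huσ, e, hρ, map_div₀, D.τκ]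
    field_simp
  have h1 : (D.ζ) ^ (6 * j) = 1 := by
    have e : D.ζ ^ 6 = D.ζ * - D.ζ := by linear_combination D.ζ ^ 2 * D.z4
    rw [pow_mul, e, mul_pow, ← hj]
    have : (-D.ζ) ^ j = (D.τ ω) ^ m := by
      rw [← map_pow, hj, map_pow, D.hτζ]
    rw [this, ← mul_pow, hωτ, one_pow]
  have h2 : 8 ∣ 6 * j := D.hζ.dvd_of_pow_eq_one _ h1
  have h3 : (ω * D.σ ω) ^ m = 1 := by
    rw [mul_pow, ← map_pow, hj, map_pow, D.hσζ, ← pow_add, D.hζ.pow_eq_one_iff_dvd]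
    omega
  have h4 : (D.τ ρ / ρ) ^ m' = 1 := by
    rw [div_pow, ← map_pow, ha, map_pow, D.hτζ, hae.neg_pow, div_self (pow_ne_zero _ D.zne)]
  have h5 : (ω * D.σ ω) ^ (m * m') = 1 := by rw [pow_mul, h3, one_pow]
  rw [hωσ, (hm.mul hm').neg_pow, mul_comm m, pow_mul, h4, one_pow] at h5
  have : (2 : L) = 0 := by linear_combination - h5
  exact two_ne_zero this

end Dat
end

section

namespace Dat
variable {p : ℕ} {L : Type} [Field L] [NumberField L] (D : Dat p L)

lemma eight (D : Dat p L) : ∃ n : ℕ, p + 1 = 8 * n := ⟨(p + 1) / 8, by have := D.hp8; omega⟩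

/-- the integer `(1 + √-p)/2` -/
noncomputable def thL : L := (1 + D.ζ ^ 2 * D.s) / 2

lemma thL_eq (n : ℕ) (hn : p + 1 = 8 * n) : D.thL ^ 2 - D.thL + 2 * n = 0 := by
  have hn' : (p : L) + 1 = 8 * n := by exact_mod_cast hn
  have h1 : (D.ζ ^ 2 * D.s) ^ 2 = - p := by
    rw [mul_pow, D.hs]; linear_combination p * D.z4
  rw [thL]
  linear_combination (1 / 4) * h1 - (1 / 4) * hn'

lemma thL_int : IsIntegral ℤ D.thL := by
  obtain ⟨n, hn⟩ := D.eight
  have h := D.thL_eq n hn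
  refine ⟨Polynomial.X ^ 2 - Polynomial.X + Polynomial.C (2 * n : ℤ), by monicity!, ?_⟩
  simpa using h

noncomputable def th : 𝓞 L := ⟨D.thL, D.thL_int⟩
noncomputable def z : 𝓞 L := ⟨D.ζ, D.zint⟩
noncomputable def σR : 𝓞 L ≃+* 𝓞 L := RingOfIntegers.mapRingEquiv (D.σ : L ≃+* L)
noncomputable def τR : 𝓞 L ≃+* 𝓞 L := RingOfIntegers.mapRingEquiv (D.τ : L ≃+* L)

lemma σR_coe (x : 𝓞 L) : ((D.σR x : 𝓞 L) : L) = D.σ x := rfl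
lemma τR_coe (x : 𝓞 L) : ((D.τR x : 𝓞 L) : L) = D.τ x := rfl
lemma z_coe : (D.z : L) = D.ζ := rfl
lemma th_coe : (D.th : L) = D.thL := rfl

lemma Rz4 : D.z ^ 4 = -1 := by
  apply RingOfIntegers.ext; simpa [z_coe] using D.z4
lemma σz : D.σR D.z = D.z := RingOfIntegers.ext D.hσζ
lemma τz : D.τR D.z = - D.z := by
  apply RingOfIntegers.ext; simpa [z_coe, τR_coe] using D.hτζ
lemma σthL : D.σ D.thL = 1 - D.thL := by
  rw [thL]
  simp only [map_div₀, map_add, map_mul, map_pow, map_one, D.hσs, D.hσζ, map_ofNat]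
  ring
lemma σth : D.σR D.th = 1 - D.th := by
  apply RingOfIntegers.ext; simpa [th_coe, σR_coe] using D.σthL
lemma τth : D.τR D.th = D.th := by
  apply RingOfIntegers.ext
  rw [τR_coe, th_coe, thL]
  simp only [map_div₀, map_add, map_mul, map_pow, map_one, D.hτs, D.hτζ, map_ofNat]
  ring
lemma th_eq : ∃ n : 𝓞 L, D.th * (1 - D.th) = 2 * n := by
  obtain ⟨n, hn⟩ := D.eight
  have h := D.thL_eq n hn
  have : D.th ^ 2 - D.th + 2 * n = 0 := by
    apply RingOfIntegers.ext; simpa [th_coe, show (algebraMap (𝓞 L) L) 2 = 2 from map_ofNat _ 2] using h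
  exact ⟨n, by linear_combination -this⟩

noncomputable def IL : Ideal (𝓞 L) := Ideal.span {1 - D.z, D.th}

lemma IL_τ : D.IL.map D.τR = D.IL := by
  rw [IL, Ideal.map_span, Set.image_pair]
  simp only [map_sub, map_one, D.τz, D.τth]
  apply le_antisymm <;> rw [Ideal.span_le]
  · rintro x (rfl | rfl)
    · rw [SetLike.mem_coe, Ideal.mem_span_pair]
      exact ⟨D.z + D.z ^ 2 + D.z ^ 3, 0, by linear_combination -D.Rz4⟩
    · exact Ideal.subset_span (by simp)
  · rintro x (rfl | rfl)
    · rw [SetLike.mem_coe, Ideal.mem_span_pair]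
      exact ⟨- D.z + D.z ^ 2 - D.z ^ 3, 0, by linear_combination -D.Rz4⟩
    · exact Ideal.subset_span (by simp)

lemma IL_σ : D.IL * D.IL.map D.σR = Ideal.span {1 - D.z} := by
  obtain ⟨n, hn⟩ := D.th_eq
  rw [IL, Ideal.map_span, Set.image_pair]
  simp only [map_sub, map_one, D.σz, D.σth]
  rw [Ideal.span_pair_mul_span_pair]
  apply le_antisymm
  · rw [Ideal.span_le]
    rintro x (rfl | rfl | rfl | rfl) <;> rw [SetLike.mem_coe, Ideal.mem_span_singleton']
    · exact ⟨_, rfl⟩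
    · exact ⟨_, mul_comm _ _⟩
    · exact ⟨_, rfl⟩
    · exact ⟨(1 + D.z + D.z ^ 2 + D.z ^ 3) * n, by rw [hn]; linear_combination - n * D.Rz4⟩
  · rw [Ideal.span_singleton_le_iff_mem]
    have h1 : (1 - D.z) * (1 - D.th) ∈ Ideal.span {(1 - D.z) * (1 - D.z), (1 - D.z) * (1 - D.th),
      D.th * (1 - D.z), D.th * (1 - D.th)} := Ideal.subset_span (by simp)
    have h2 : D.th * (1 - D.z) ∈ Ideal.span {(1 - D.z) * (1 - D.z), (1 - D.z) * (1 - D.th),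
      D.th * (1 - D.z), D.th * (1 - D.th)} := Ideal.subset_span (by simp)
    have := Ideal.add_mem _ h1 h2
    convert this using 1
    ring

lemma Rlam_ne : 1 - D.z ≠ 0 := by
  intro h
  exact D.lam_ne (by simpa [z_coe] using congrArg (fun x : 𝓞 L => (x : L)) h)

lemma IL_ne : D.IL ≠ ⊥ := by
  intro h
  have : 1 - D.z ∈ D.IL := Ideal.subset_span (by simp)
  rw [h] at this
  exact D.Rlam_ne this

lemma assoc_div {a b : 𝓞 L} (hb : b ≠ 0) (h : Associated b a) :
    IsIntegral ℤ ((a : L) / b) ∧ IsIntegral ℤ ((a : L) / b)⁻¹ := by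
  obtain ⟨u, rfl⟩ := h
  have hb' : (b : L) ≠ 0 := by simpa using hb
  have e1 : (((b * u : 𝓞 L)) : L) / b = ((u : 𝓞 L) : L) := by
    push_cast; field_simp
  have e2 : (((u : 𝓞 L) : L))⁻¹ = (((u⁻¹ : (𝓞 L)ˣ) : 𝓞 L) : L) := by
    refine inv_eq_of_mul_eq_one_right ?_
    rw [← map_mul, Units.mul_inv, map_one]
  rw [e1, e2]
  exact ⟨RingOfIntegers.isIntegral_coe _, RingOfIntegers.isIntegral_coe _⟩

theorem even_card (D : Dat p L) : Even (Nat.card (ClassGroup (𝓞 L))) := by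
  by_contra hodd
  rw [Nat.not_even_iff_odd] at hodd
  set h := Nat.card (ClassGroup (𝓞 L)) with hh
  have hpr : (D.IL ^ h).IsPrincipal := by
    have hm : D.IL ∈ nonZeroDivisors (Ideal (𝓞 L)) := mem_nonZeroDivisors_of_ne_zero D.IL_ne
    have h1 : ClassGroup.mk0 (⟨D.IL, hm⟩ ^ h) = 1 := by rw [map_pow, hh, pow_card_eq_one']
    exact (ClassGroup.mk0_eq_one_iff (pow_mem hm h)).1 h1
  obtain ⟨δ, hδ⟩ := hpr
  rw [Ideal.submodule_span_eq] at hδ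
  have hδ0 : δ ≠ 0 := by
    rintro rfl
    rw [Ideal.span_singleton_zero] at hδ
    exact pow_ne_zero h D.IL_ne hδ
  have h1 : Associated δ (D.τR δ) := by
    rw [← Ideal.span_singleton_eq_span_singleton, ← hδ]
    have := congrArg (Ideal.map D.τR) hδ
    rw [Ideal.map_pow, D.IL_τ, Ideal.map_span, Set.image_singleton] at this
    exact this
  have h2 : Associated ((1 - D.z) ^ h) (δ * D.σR δ) := by
    rw [← Ideal.span_singleton_eq_span_singleton, ← Ideal.span_singleton_mul_span_singleton, ← hδ]
    have := congrArg (Ideal.map D.σR) hδ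
    rw [Ideal.map_pow, Ideal.map_span, Set.image_singleton] at this
    rw [← this, ← mul_pow, D.IL_σ, Ideal.span_singleton_pow]
  obtain ⟨i1, i2⟩ := assoc_div hδ0 h1
  obtain ⟨i3, i4⟩ := assoc_div (pow_ne_zero h D.Rlam_ne) h2
  refine D.low_field (δ := δ) (by simpa using hδ0) hodd i1 i2 ?_ ?_
  · simpa [z_coe, σR_coe] using i3
  · simpa [z_coe, σR_coe] using i4

end Dat
end

section

namespace Dat
variable {p : ℕ} {L : Type} [Field L] [NumberField L] (D : Dat p L)

/-- the subfield `ℚ(ζ₈)` -/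
abbrev K : IntermediateField ℚ L := IntermediateField.adjoin ℚ {D.ζ}

lemma gal (f : L ≃ₐ[D.K] L) : f = 1 ∨ f = D.σ := by
  have hfζ : f D.ζ = D.ζ :=
    f.commutes ⟨D.ζ, IntermediateField.mem_adjoin_simple_self ℚ D.ζ⟩
  have hf : f D.s = D.s ∨ f D.s = - D.s := by
    rw [← sq_eq_sq_iff_eq_or_eq_neg, ← map_pow, D.hs, map_natCast]
  rcases hf with hf | hf
  · left
    ext x
    exact DFunLike.congr_fun (D.ext ((f.restrictScalars ℚ : L ≃ₐ[ℚ] L) : L →ₐ[ℚ] L)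
      (AlgHom.id ℚ L) hfζ hf) x
  · right
    ext x
    exact DFunLike.congr_fun (D.ext ((f.restrictScalars ℚ : L ≃ₐ[ℚ] L) : L →ₐ[ℚ] L)
      D.σ0 (hfζ.trans D.hσζ.symm) (hf.trans D.hσs.symm)) x

lemma σne : (1 : L ≃ₐ[D.K] L) ≠ D.σ := by
  intro h
  have h1 : D.s = - D.s := by
    have := DFunLike.congr_fun h D.s
    rw [D.hσs] at this
    exact this
  have : (2 : L) * D.s = 0 := by linear_combination h1
  exact D.sne (by simpa using this)

lemma gal_univ [DecidableEq (L ≃ₐ[D.K] L)] : (Finset.univ : Finset (L ≃ₐ[D.K] L)) = {1, D.σ} := by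
  ext f
  simpa using D.gal f

lemma isGal : IsGalois D.K L := by
  have := D_normal D.hζ D.hs D.hgen
  infer_instance

lemma norm_eq (x : L) : algebraMap D.K L (Algebra.norm D.K x) = x * D.σ x := by
  classical
  have := D.isGal
  rw [Algebra.norm_eq_prod_automorphisms, D.gal_univ, Finset.prod_pair D.σne]
  rfl

lemma finrank_K : Module.finrank D.K L = 2 := by
  classical
  have := D.isGal
  rw [← IsGalois.card_aut_eq_finrank, Nat.card_eq_fintype_card, ← Finset.card_univ, D.gal_univ,
    Finset.card_pair D.σne]

lemma finrank_L (D : Dat p L) : Module.finrank ℚ L = 8 := by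
  have := D.cyc
  rw [← Module.finrank_mul_finrank ℚ D.K L, D.finrank_K, B_finrank D.K]

lemma rank_K : Units.rank D.K = 1 := by
  have := D.cyc
  have h2 := InfinitePlace.card_eq_nrRealPlaces_add_nrComplexPlaces D.K
  rw [Units.rank, h2, B_real, B_complex]

lemma rank_L (D : Dat p L) : Units.rank L = 3 := by
  have := D.cyc
  have h1 : IsTotallyComplex D.K := IsCyclotomicExtension.Rat.isTotallyComplex (n := 8) D.K (by norm_num)
  have : IsTotallyComplex L := isTotallyComplex_of_algebra D.K L
  have h2 := InfinitePlace.card_eq_nrRealPlaces_add_nrComplexPlaces L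
  have h3 := IsTotallyComplex.nrRealPlaces_eq_zero L
  have h4 := InfinitePlace.card_add_two_mul_card_eq_rank L
  rw [D.finrank_L] at h4
  rw [Units.rank, h2, h3]
  omega

lemma card_EL (D : Dat p L) :
    Nat.card ((𝓞 L)ˣ ⧸ (powMonoidHom 2 : (𝓞 L)ˣ →* (𝓞 L)ˣ).range) = 16 := by
  rw [C_card, D.rank_L]; norm_num

lemma card_EK :
    Nat.card ((𝓞 D.K)ˣ ⧸ (powMonoidHom 2 : (𝓞 D.K)ˣ →* (𝓞 D.K)ˣ).range) = 4 := by
  rw [C_card, D.rank_K]; norm_num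

/-- inclusion of rings of integers -/
noncomputable def inc : 𝓞 D.K →+* 𝓞 L := algebraMap (𝓞 D.K) (𝓞 L)

lemma inc_coe (a : 𝓞 D.K) : ((D.inc a : 𝓞 L) : L) = ((a : D.K) : L) := rfl

lemma inc_inj : Function.Injective D.inc := by
  intro a b h
  have := congrArg (fun x : 𝓞 L => (x : L)) h
  simp only [inc_coe] at this
  exact RingOfIntegers.ext (Subtype.ext this)

lemma σK (a : D.K) : D.σ (a : L) = a := D.σ.commutes a

lemma σ_inc (a : 𝓞 D.K) : D.σR (D.inc a) = D.inc a := RingOfIntegers.ext (D.σK _)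

lemma desc {x : 𝓞 L} (hx : D.σR x = x) : ∃ a, D.inc a = x := by
  obtain ⟨y, hy⟩ := D.fixed (x := (x : L)) (congrArg (fun x : 𝓞 L => (x : L)) hx)
  have hi : IsIntegral ℤ (x : L) := RingOfIntegers.isIntegral_coe x
  rw [← hy] at hi
  have hy' : IsIntegral ℤ y :=
    (isIntegral_algebraMap_iff (A := D.K) (B := L) (algebraMap D.K L).injective).1 hi
  exact ⟨⟨y, hy'⟩, RingOfIntegers.ext hy⟩

lemma inc_dvd {a b : 𝓞 D.K} (h : D.inc a ∣ D.inc b) : a ∣ b := by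
  obtain ⟨r, hr⟩ := h
  by_cases ha : a = 0
  · subst ha
    rw [map_zero, zero_mul, ← map_zero D.inc] at hr
    rw [D.inc_inj hr]
  have ha' : D.inc a ≠ 0 := by
    rw [← map_zero D.inc]; exact fun h => ha (D.inc_inj h)
  have h1 : D.σR r = r := by
    refine mul_left_cancel₀ ha' ?_
    have := congrArg D.σR hr
    rw [map_mul, D.σ_inc, D.σ_inc] at this
    rw [← hr, ← this]
  obtain ⟨c, rfl⟩ := D.desc h1
  exact ⟨c, D.inc_inj (by rw [hr, map_mul])⟩

lemma normR (x : 𝓞 L) (I : Ideal (𝓞 L)) (hI : Ideal.span {x} = I ^ 2) :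
    ∃ (ε : (𝓞 D.K)ˣ) (b : 𝓞 D.K), x * D.σR x = D.inc (ε * b ^ 2) := by
  have := D.cyc
  have := B_pid D.K
  have h1 := congrArg (Ideal.relNorm (𝓞 D.K)) hI
  rw [Ideal.relNorm_singleton, map_pow] at h1
  obtain ⟨b, hb⟩ := (IsPrincipalIdealRing.principal (Ideal.relNorm (𝓞 D.K) I)).1
  rw [hb, Ideal.submodule_span_eq, Ideal.span_singleton_pow,
    Ideal.span_singleton_eq_span_singleton] at h1
  obtain ⟨u, hu⟩ := h1.symm
  refine ⟨u, b, ?_⟩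
  rw [mul_comm (u : 𝓞 D.K), hu]
  apply RingOfIntegers.ext
  have h2 := Algebra.algebraMap_intNorm (A := 𝓞 D.K) (K := D.K) (L := L) (B := 𝓞 L) x
  rw [inc_coe]
  exact ((congrArg (algebraMap D.K L) h2).trans (D.norm_eq x)).symm

end Dat
end

section

section
variable (K : Type*) [Field K] [NumberField K] [IsCyclotomicExtension {8} ℚ K]

/-- the absolute norm of an element -/
noncomputable def aN {K : Type*} [Field K] [NumberField K] (x : 𝓞 K) : ℕ :=
  Ideal.absNorm (Ideal.span {x})

lemma aN_mul (x y : 𝓞 K) : aN (x * y) = aN x * aN y := by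
  rw [aN, aN, aN, ← map_mul, Ideal.span_singleton_mul_span_singleton]

lemma aN_unit {x : 𝓞 K} : aN x = 1 ↔ IsUnit x := by
  rw [aN, Ideal.absNorm_eq_one_iff, Ideal.span_singleton_eq_top]

lemma aN_p (p : ℕ) : aN (p : 𝓞 K) = p ^ 4 := by
  rw [aN, Ideal.absNorm_span_singleton, show (p : 𝓞 K) = algebraMap ℤ (𝓞 K) p by simp,
    Algebra.norm_algebraMap, RingOfIntegers.rank, B_finrank]
  simp [Int.natAbs_pow]

lemma aN_ne_p {p : ℕ} (hp : p.Prime) (hp8 : p % 8 = 7) {x : 𝓞 K} (hx : x ∣ (p : 𝓞 K)) :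
    aN x ≠ p := by
  intro h
  have hζ := IsCyclotomicExtension.zeta_spec 8 ℚ K
  have hpr : (Ideal.span {x}).IsPrime := Ideal.isPrime_of_irreducible_absNorm (by
    change Irreducible (aN x); rw [h]; exact hp)
  have hx0 : x ≠ 0 := by
    rintro rfl
    have := zero_dvd_iff.1 hx
    exact hp.ne_zero (by exact_mod_cast this)
  have hmax : (Ideal.span {x}).IsMaximal := hpr.isMaximal (by simpa using hx0)
  let _ := Ideal.Quotient.field (Ideal.span {x})
  have hcard : Nat.card (𝓞 K ⧸ Ideal.span {x}) = p := by
    rw [← h, aN, Ideal.absNorm_apply, Submodule.cardQuot_apply]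
  have : Finite (𝓞 K ⧸ Ideal.span {x}) := Nat.finite_of_card_ne_zero (by rw [hcard]; exact hp.ne_zero)
  let _ := Fintype.ofFinite (𝓞 K ⧸ Ideal.span {x})
  have hc : Fintype.card (𝓞 K ⧸ Ideal.span {x}) = p := by rw [← Nat.card_eq_fintype_card, hcard]
  set q := Ideal.Quotient.mk (Ideal.span {x}) with hq
  set z := q hζ.toInteger with hz
  have h8 : z ^ 8 = 1 := by
    rw [hz, ← map_pow, hζ.toInteger_isPrimitiveRoot.pow_eq_one, map_one]
  have h4 : z ^ 4 = -1 := by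
    have h1 : hζ.toInteger ^ 4 ≠ 1 :=
      hζ.toInteger_isPrimitiveRoot.pow_ne_one_of_pos_of_lt (by norm_num) (by norm_num)
    have h2 : (hζ.toInteger ^ 4 - 1) * (hζ.toInteger ^ 4 + 1) = 0 := by
      linear_combination hζ.toInteger_isPrimitiveRoot.pow_eq_one
    have h3 := (mul_eq_zero.1 h2).resolve_left (sub_ne_zero.2 h1)
    have := congrArg q h3
    rw [map_add, map_pow, map_one, map_zero] at this
    linear_combination this
  have h1 : z ^ p = z := by
    have := FiniteField.pow_card z
    rwa [hc] at this
  have h7 : z ^ 7 = z := by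
    rw [← h1]
    nth_rewrite 2 [← Nat.div_add_mod p 8]
    rw [hp8, pow_add, pow_mul, h8, one_pow, one_mul, h1]
  have h2 : (2 : 𝓞 K ⧸ Ideal.span {x}) = 0 := by
    have e1 : z ^ 2 = 1 := by linear_combination h8 - z * h7
    linear_combination h4 - (z ^ 2 + 1) * e1
  have hpz : ((p : ℕ) : 𝓞 K ⧸ Ideal.span {x}) = 0 := by
    have : q (p : 𝓞 K) = 0 := by
      rw [hq, Ideal.Quotient.eq_zero_iff_mem, Ideal.mem_span_singleton]; exact hx
    rwa [map_natCast] at this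
  have h3 : ((p : ℕ) : 𝓞 K ⧸ Ideal.span {x}) = 1 := by
    conv_lhs => rw [show p = 2 * (p / 2) + 1 by omega]
    push_cast
    rw [h2]; ring
  exact one_ne_zero (h3.symm.trans hpz)

lemma aN_ge {p : ℕ} (hp : p.Prime) (hp8 : p % 8 = 7) {x : 𝓞 K} (hx : x ∣ (p : 𝓞 K))
    (hu : ¬ IsUnit x) : ∃ j, 2 ≤ j ∧ aN x = p ^ j := by
  have h1 : aN x ∣ p ^ 4 := by
    obtain ⟨y, hy⟩ := hx
    rw [← aN_p K p, hy, aN_mul]; exact dvd_mul_right _ _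
  obtain ⟨j, hj, e⟩ := (Nat.dvd_prime_pow hp).1 h1
  refine ⟨j, ?_, e⟩
  by_contra hlt
  have : j = 0 ∨ j = 1 := by omega
  rcases this with rfl | rfl
  · exact hu ((aN_unit K).1 (by simpa using e))
  · exact aN_ne_p K hp hp8 hx (by simpa using e)

lemma div_p {p : ℕ} (hp : p.Prime) (hp8 : p % 8 = 7) :
    ∃ π : 𝓞 K, π ≠ 0 ∧ ∀ c, c ∣ (p : 𝓞 K) → ∃ ε : (𝓞 K)ˣ,
      c = ε ∨ c = ε * π ∨ c * π = ε * p ∨ c = ε * p := by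
  have hpid := B_pid K
  by_cases hirr : Irreducible (p : 𝓞 K)
  · refine ⟨1, one_ne_zero, fun c hc => ?_⟩
    rcases hirr.dvd_iff.1 hc with h | h
    · obtain ⟨u, rfl⟩ := h
      exact ⟨u, Or.inl rfl⟩
    · obtain ⟨u, hu⟩ := h
      exact ⟨u, Or.inr (Or.inr (Or.inr (by rw [mul_comm]; exact hu.symm)))⟩
  · have hnu := D_not_unit K hp
    have h0 : (p : 𝓞 K) ≠ 0 := by exact_mod_cast hp.ne_zero
    rw [irreducible_iff] at hirr
    push Not at hirr
    obtain ⟨a, b, hab, ha, hb⟩ := hirr hnu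
    obtain ⟨j, hj, ej⟩ := aN_ge K hp hp8 ⟨b, hab⟩ ha
    obtain ⟨k, hk, ek⟩ := aN_ge K hp hp8 ⟨a, by rw [hab, mul_comm]⟩ hb
    have hjk : j + k = 4 := by
      have := aN_p K p
      rw [hab, aN_mul, ej, ek, ← pow_add] at this
      exact Nat.pow_right_injective hp.two_le this
    have key : ∀ a : 𝓞 K, a ∣ (p : 𝓞 K) → ¬ IsUnit a → aN a = p ^ 2 → Irreducible a := by
      intro a had ha e
      rw [irreducible_iff]
      refine ⟨ha, fun x y hxy => ?_⟩
      by_contra hcon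
      push Not at hcon
      obtain ⟨i, hi, ei⟩ := aN_ge K hp hp8 (dvd_trans ⟨y, hxy⟩ had) hcon.1
      obtain ⟨l, hl, el⟩ := aN_ge K hp hp8 (dvd_trans ⟨x, by rw [hxy, mul_comm]⟩ had) hcon.2
      rw [hxy, aN_mul, ei, el, ← pow_add] at e
      have := Nat.pow_right_injective hp.two_le e
      omega
    have hia := key a ⟨b, hab⟩ ha (by rw [ej]; congr 1; omega)
    have hib := key b ⟨a, by rw [hab, mul_comm]⟩ hb (by rw [ek]; congr 1; omega)
    refine ⟨a, hia.ne_zero, fun c hc => ?_⟩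
    rw [hab] at hc
    obtain ⟨c1, c2, h1, h2, rfl⟩ := exists_dvd_and_dvd_of_dvd_mul hc
    rw [hab]
    rcases hia.dvd_iff.1 h1 with ⟨u, rfl⟩ | ⟨u, rfl⟩ <;>
    rcases hib.dvd_iff.1 h2 with ⟨v, rfl⟩ | ⟨v, rfl⟩
    · exact ⟨u * v, Or.inl (by push_cast; ring)⟩
    · exact ⟨u * v, Or.inr (Or.inr (Or.inl (by push_cast; ring)))⟩
    · exact ⟨u * v, Or.inr (Or.inl (by push_cast; ring))⟩
    · exact ⟨u * v, Or.inr (Or.inr (Or.inr (by push_cast; ring)))⟩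

lemma sqfree_part {R : Type*} [CommRing R] [IsDomain R] [WfDvdMonoid R] (c : R) (hc : c ≠ 0) :
    ∃ d e : R, Squarefree e ∧ c = d ^ 2 * e := by
  revert hc
  refine wellFounded_dvdNotUnit.induction (C := fun c : R => c ≠ 0 →
    ∃ d e : R, Squarefree e ∧ c = d ^ 2 * e) c ?_
  intro c ih hc
  by_cases hs : Squarefree c
  · exact ⟨1, c, hs, by ring⟩
  · rw [Squarefree] at hs
    push Not at hs
    obtain ⟨x, ⟨y, hy⟩, hx⟩ := hs
    have hy0 : y ≠ 0 := by
      rintro rfl; exact hc (by rw [hy, mul_zero])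
    have hxx : ¬ IsUnit (x * x) := fun h => hx (isUnit_of_mul_isUnit_left h)
    obtain ⟨d, e, he, h⟩ := ih y ⟨hy0, x * x, hxx, by rw [hy]; ring⟩ hy0
    exact ⟨x * d, e, he, by rw [hy, h]; ring⟩
end
end

section

namespace Dat
variable {p : ℕ} {L : Type} [Field L] [NumberField L] (D : Dat p L)

lemma σRσR (x : 𝓞 L) : D.σR (D.σR x) = x := RingOfIntegers.ext (D.σσ x)

lemma dvd_trace {c : 𝓞 D.K} (hc : Squarefree c) {x : 𝓞 L} (hx : D.inc c ∣ x ^ 2) :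
    D.inc c ∣ x + D.σR x := by
  have := D.cyc
  have := B_pid D.K
  have hc0 : c ≠ 0 := hc.ne_zero
  have hc' : D.inc c ≠ 0 := by
    rw [← map_zero D.inc]; exact fun h => hc0 (D.inc_inj h)
  obtain ⟨r, hr⟩ := hx
  have hr' : D.σR x ^ 2 = D.inc c * D.σR r := by
    rw [← map_pow, hr, map_mul, D.σ_inc]
  have h1 : D.inc c ∣ x * D.σR x := by
    have : D.inc c ^ 2 ∣ (x * D.σR x) ^ 2 := ⟨r * D.σR r, by rw [mul_pow, hr, hr']; ring⟩
    exact (IsIntegrallyClosed.pow_dvd_pow_iff (by norm_num)).1 this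
  obtain ⟨q, hq⟩ := h1
  obtain ⟨t, ht⟩ := D.desc (x := x + D.σR x) (by rw [map_add, D.σRσR, add_comm])
  have h2 : D.inc c ∣ D.inc (t ^ 2) := by
    refine ⟨r + D.σR r + 2 * q, ?_⟩
    rw [map_pow, ht]
    linear_combination hr + hr' + 2 * hq
  have h3 := (hc.dvd_pow_iff_dvd (by norm_num)).1 (D.inc_dvd h2)
  rw [← ht]
  exact map_dvd D.inc h3

noncomputable def sR : 𝓞 L := ⟨D.s, IsIntegral.of_pow (n := 2) (by norm_num)
  (by rw [D.hs]; exact_mod_cast isIntegral_algebraMap (R := ℤ) (A := L) (x := (p : ℤ)))⟩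

lemma sR_coe : (D.sR : L) = D.s := rfl
lemma sR_sq : D.sR ^ 2 = p := RingOfIntegers.ext (by simpa [sR_coe] using D.hs)

lemma th_sub : D.th - D.σR D.th = D.z ^ 2 * D.sR := by
  rw [D.σth]
  apply RingOfIntegers.ext
  simp only [map_sub, map_mul, map_pow, map_one, th_coe, z_coe, sR_coe, thL]
  ring

lemma ram {c : 𝓞 D.K} (hc : Squarefree c) {J : Ideal (𝓞 L)} (hJ : Ideal.span {D.inc c} = J ^ 2) :
    c ∣ (p : 𝓞 D.K) := by
  have := D.cyc
  have := B_pid D.K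
  have hc0 : c ≠ 0 := hc.ne_zero
  have hc' : D.inc c ≠ 0 := by
    rw [← map_zero D.inc]; exact fun h => hc0 (D.inc_inj h)
  have hJ0 : J ≠ ⊥ := by
    rintro rfl
    apply hc'
    have : (⊥ : Ideal (𝓞 L)) ^ 2 = ⊥ := by rw [Ideal.bot_pow (by norm_num)]
    rw [this, Ideal.span_singleton_eq_bot] at hJ
    exact hJ
  have h1 : ∀ x ∈ J, D.inc c ∣ D.sR * x := by
    intro x hx
    have hx2 : D.inc c ∣ x ^ 2 := by
      rw [← Ideal.mem_span_singleton, hJ]; exact Ideal.pow_mem_pow hx 2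
    have hy2 : D.inc c ∣ (D.th * x) ^ 2 := by
      rw [mul_pow]; exact Dvd.dvd.mul_left hx2 _
    have t1 := D.dvd_trace hc hx2
    have t2 := D.dvd_trace hc hy2
    have t3 : D.inc c ∣ D.z ^ 2 * D.sR * x := by
      have : D.z ^ 2 * D.sR * x = (D.th * x + D.σR (D.th * x)) - D.σR D.th * (x + D.σR x) := by
        rw [← D.th_sub, map_mul]; ring
      rw [this]
      exact dvd_sub t2 (Dvd.dvd.mul_left t1 _)
    have : D.sR * x = - D.z ^ 2 * (D.z ^ 2 * D.sR * x) := by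
      linear_combination D.sR * x * D.Rz4
    rw [this]
    exact Dvd.dvd.mul_left t3 _
  have h2 : J * J ∣ J * Ideal.span {D.sR} := by
    rw [Ideal.dvd_iff_le, mul_comm J, Ideal.span_singleton_mul_le_iff, ← pow_two, ← hJ]
    intro x hx
    rw [Ideal.mem_span_singleton]
    exact h1 x hx
  have h3 : J ∣ Ideal.span {D.sR} := (mul_dvd_mul_iff_left hJ0).1 h2
  have h4 := pow_dvd_pow_of_dvd h3 2
  rw [← hJ, Ideal.span_singleton_pow, D.sR_sq, Ideal.dvd_iff_le, Ideal.span_singleton_le_span_singleton] at h4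
  refine D.inc_dvd ?_
  rw [map_natCast]
  exact h4

lemma ker1 {x : 𝓞 L} (hx : x ≠ 0) {I : Ideal (𝓞 L)} (hI : Ideal.span {x} = I ^ 2)
    {k : L} (hk : D.σ k = k) (hxk : (x : L) * D.σ x = k ^ 2) :
    ∃ c : 𝓞 D.K, c ∣ (p : 𝓞 D.K) ∧ ∃ g : L, g ≠ 0 ∧ (x : L) = (D.inc c : 𝓞 L) * g ^ 2 := by
  have := D.cyc
  have := B_pid D.K
  have hx0 : (x : L) ≠ 0 := by simpa using hx
  have hσx : D.σ (x : L) ≠ 0 := by simpa using hx0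
  have hk0 : k ≠ 0 := by
    rintro rfl
    exact mul_ne_zero hx0 hσx (by rw [hxk]; ring)
  -- Hilbert 90
  obtain ⟨k', β, hk', hβ, e⟩ : ∃ k' β : L, D.σ k' = k' ∧ β ≠ 0 ∧ (x : L) = k' * β ^ 2 := by
    by_cases ht : (x : L) = - k
    · exact ⟨-k, 1, by rw [map_neg, hk], one_ne_zero, by rw [ht]; ring⟩
    · have hs : k + x ≠ 0 := fun h => ht (by linear_combination h)
      have hs' : k + D.σ x ≠ 0 := by
        intro h
        apply hs
        have := congrArg D.σ h
        rw [map_add, hk, D.σσ, map_zero] at this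
        exact this
      refine ⟨k / ((k + x) * (k + D.σ x)), k + x, ?_, hs, ?_⟩
      · rw [map_div₀, map_mul, map_add, map_add, hk, D.σσ, mul_comm (k + D.σ x)]
      · field_simp
        linear_combination hxk
  -- write the factor as integral times square
  obtain ⟨y, hy⟩ := D.fixed hk'
  have hk0' : k' ≠ 0 := by
    rintro rfl; exact hx0 (by rw [e]; ring)
  obtain ⟨a, m, hm, ham⟩ := IsFractionRing.div_surjective (A := 𝓞 D.K) y
  have hm0 : m ≠ 0 := nonZeroDivisors.ne_zero hm
  have ha0 : a ≠ 0 := by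
    rintro rfl
    rw [map_zero, zero_div] at ham
    exact hk0' (by rw [← hy, ← ham]; rfl)
  obtain ⟨d, c, hc, hdc⟩ := sqfree_part (a * m) (mul_ne_zero ha0 hm0)
  have hc0 : c ≠ 0 := hc.ne_zero
  have hd0 : d ≠ 0 := by
    rintro rfl; exact mul_ne_zero ha0 hm0 (by rw [hdc]; ring)
  have hcoe : ∀ t : 𝓞 D.K, t ≠ 0 → ((D.inc t : 𝓞 L) : L) ≠ 0 := by
    intro t ht h
    have : D.inc t = 0 := by simpa using h
    exact ht (D.inc_inj (by rw [this, map_zero]))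
  have e1 : k' = (D.inc c : 𝓞 L) * (((D.inc d : 𝓞 L) : L) / (D.inc m : 𝓞 L)) ^ 2 := by
    have h1 : k' = ((D.inc a : 𝓞 L) : L) / (D.inc m : 𝓞 L) := by
      rw [← hy, ← ham]; rfl
    have h2 : ((D.inc a : 𝓞 L) : L) * (D.inc m : 𝓞 L) = ((D.inc d : 𝓞 L) : L) ^ 2 * (D.inc c : 𝓞 L) := by
      rw [← map_mul, ← map_mul, hdc, map_mul, map_pow, map_mul, map_pow]
    have := hcoe m hm0
    rw [h1]
    field_simp
    linear_combination h2
  set g : L := ((D.inc d : 𝓞 L) : L) / (D.inc m : 𝓞 L) * β with hg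
  have hg0 : g ≠ 0 := mul_ne_zero (div_ne_zero (hcoe d hd0) (hcoe m hm0)) hβ
  have e2 : (x : L) = (D.inc c : 𝓞 L) * g ^ 2 := by
    rw [e, e1, hg]; ring
  refine ⟨c, ?_, g, hg0, e2⟩
  obtain ⟨b, n, hn, hbn⟩ := IsFractionRing.div_surjective (A := 𝓞 L) g
  have hn0 : n ≠ 0 := nonZeroDivisors.ne_zero hn
  have hn0' : (n : L) ≠ 0 := by simpa using hn0
  have hb0 : b ≠ 0 := by
    rintro rfl; exact hg0 (by rw [← hbn]; simp)
  have e3 : n ^ 2 * x = D.inc c * b ^ 2 := by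
    apply RingOfIntegers.ext
    simp only [map_mul, map_pow]
    have e2' : algebraMap (𝓞 L) L x = (algebraMap (𝓞 L) L (D.inc c)) * g ^ 2 := e2
    have hn0'' : algebraMap (𝓞 L) L n ≠ 0 := hn0'
    rw [e2', ← hbn]
    field_simp
  have e4 : (Ideal.span {n} * I) ^ 2 = Ideal.span {D.inc c} * Ideal.span {b} ^ 2 := by
    rw [mul_pow, ← hI, Ideal.span_singleton_pow, Ideal.span_singleton_pow,
      Ideal.span_singleton_mul_span_singleton, Ideal.span_singleton_mul_span_singleton, e3]
  have h5 : Ideal.span {b} ∣ Ideal.span {n} * I :=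
    (UniqueFactorizationMonoid.pow_dvd_pow_iff_dvd (n := 2) (by norm_num)).1 (by rw [e4]; exact dvd_mul_left _ _)
  obtain ⟨J, hJ⟩ := h5
  have hb0' : Ideal.span {b} ^ 2 ≠ 0 := by
    apply pow_ne_zero; simpa using hb0
  refine D.ram hc (J := J) ?_
  rw [hJ, mul_pow, mul_comm] at e4
  exact (mul_right_cancel₀ hb0' e4).symm

lemma ker2 : ∃ π : 𝓞 D.K, π ≠ 0 ∧ ∀ (x : 𝓞 L), x ≠ 0 → ∀ I : Ideal (𝓞 L), Ideal.span {x} = I ^ 2 →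
    ∀ k : L, D.σ k = k → (x : L) * D.σ x = k ^ 2 →
    ∃ (i : Bool) (ε : (𝓞 D.K)ˣ) (g : L), g ≠ 0 ∧
      (x : L) = ((D.inc (if i then π else 1) : 𝓞 L) : L) * (D.inc ε : 𝓞 L) * g ^ 2 := by
  have := D.cyc
  obtain ⟨π, hπ, h⟩ := div_p D.K D.hp D.hp8
  refine ⟨π, hπ, fun x hx I hI k hk hxk => ?_⟩
  obtain ⟨c, hc, g, hg, e⟩ := D.ker1 hx hI hk hxk
  have hπ' : ((D.inc π : 𝓞 L) : L) ≠ 0 := by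
    intro h
    have : D.inc π = 0 := by simpa using h
    exact hπ (D.inc_inj (by rw [this, map_zero]))
  obtain ⟨ε, h | h | h | h⟩ := h c hc
  · exact ⟨false, ε, g, hg, by rw [e, h]; simp⟩
  · exact ⟨true, ε, g, hg, by rw [e, h]; simp only [map_mul, if_true]; ring⟩
  · refine ⟨true, ε, D.s * g / (D.inc π : 𝓞 L), div_ne_zero (mul_ne_zero D.sne hg) hπ', ?_⟩
    have h' := congrArg (fun t => ((D.inc t : 𝓞 L) : L)) h
    simp only [map_mul, map_natCast] at h'
    rw [← D.hs] at h'
    rw [e]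
    simp only [if_true]
    field_simp
    linear_combination h'
  · refine ⟨false, ε, D.s * g, mul_ne_zero D.sne hg, ?_⟩
    rw [e, h]
    simp only [map_mul, map_natCast, Bool.false_eq_true, if_false, map_one]
    rw [← D.hs]; ring

end Dat
end

section

namespace Dat
variable {p : ℕ} {L : Type} [Field L] [NumberField L] (D : Dat p L)

/-- units modulo squares -/
abbrev EQ (F : Type) [Field F] : Type :=
  (𝓞 F)ˣ ⧸ (powMonoidHom 2 : (𝓞 F)ˣ →* (𝓞 F)ˣ).range

def Good (x : 𝓞 L) : Prop := x ≠ 0 ∧ ∃ I : Ideal (𝓞 L), Ideal.span {x} = I ^ 2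

lemma EQ_eq {F : Type} [Field F] {a b : (𝓞 F)ˣ} (h : (a : EQ F) = b) : ∃ η : (𝓞 F)ˣ, b = a * η ^ 2 := by
  obtain ⟨η, hη⟩ := QuotientGroup.eq.1 h
  refine ⟨η, ?_⟩
  rw [powMonoidHom_apply] at hη
  rw [hη]; group

lemma EQ_eq' {F : Type} [Field F] {a b η : (𝓞 F)ˣ} (h : b = a * η ^ 2) : (a : EQ F) = b :=
  QuotientGroup.eq.2 ⟨η, by rw [powMonoidHom_apply, h]; group⟩

lemma upper_fun (D : Dat p L) : ∃ (n : 𝓞 L → EQ D.K) (f : Bool × EQ D.K → L), ∀ x y, Good x → Good y →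
    n x = n y → ∃ b, ∃ g : L, g ≠ 0 ∧ (x : L) * y = f b * g ^ 2 := by
  classical
  have hn : ∀ x : 𝓞 L, ∃ ε : (𝓞 D.K)ˣ, Good x → ∃ b : 𝓞 D.K, x * D.σR x = D.inc (ε * b ^ 2) := by
    intro x
    by_cases hx : Good x
    · obtain ⟨I, hI⟩ := hx.2
      obtain ⟨ε, b, h⟩ := D.normR x I hI
      exact ⟨ε, fun _ => ⟨b, h⟩⟩
    · exact ⟨1, fun h => absurd h hx⟩
  choose n hn using hn
  obtain ⟨π, hπ, hk⟩ := D.ker2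
  refine ⟨fun x => (n x : EQ D.K), fun b => ((D.inc (if b.1 then π else 1) : 𝓞 L) : L) *
    (D.inc ((b.2.out : (𝓞 D.K)ˣ) : 𝓞 D.K) : 𝓞 L), ?_⟩
  intro x y hx hy hxy
  obtain ⟨a, ha⟩ := hn x hx
  obtain ⟨b, hb⟩ := hn y hy
  obtain ⟨η, hη⟩ := EQ_eq hxy
  obtain ⟨hx0, I, hI⟩ := hx
  obtain ⟨hy0, J, hJ⟩ := hy
  obtain ⟨i, ε, g, hg, e⟩ := hk (x * y) (mul_ne_zero hx0 hy0) (I * J)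
    (by rw [← Ideal.span_singleton_mul_span_singleton, hI, hJ, mul_pow])
    ((D.inc (n x * a * b * η) : 𝓞 L) : L) (D.σK _) (by
      have e1 : (x * y) * D.σR (x * y) = (D.inc (n x * a * b * η)) ^ 2 := by
        have : (x * y) * D.σR (x * y) = (x * D.σR x) * (y * D.σR y) := by rw [map_mul]; ring
        rw [this, ha, hb, hη, ← map_mul, ← map_pow]
        congr 1
        push_cast
        ring
      have := congrArg (fun t : 𝓞 L => (t : L)) e1
      simpa only [map_mul, map_pow, D.σR_coe] using this)
  obtain ⟨ν, hν⟩ := EQ_eq (a := (((ε : EQ D.K)).out)) (b := ε) (QuotientGroup.out_eq' _)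
  refine ⟨(i, (ε : EQ D.K)), g * (D.inc ν : 𝓞 L), mul_ne_zero hg ?_, ?_⟩
  · intro h
    have : D.inc ν = 0 := by simpa using h
    exact ν.ne_zero (D.inc_inj (by rw [this, map_zero]))
  · refine (map_mul (algebraMap (𝓞 L) L) x y).symm.trans (e.trans ?_)
    have : (D.inc (ε : 𝓞 D.K)) = D.inc (((ε : EQ D.K).out : (𝓞 D.K)ˣ) : 𝓞 D.K) * D.inc ν ^ 2 := by
      conv_lhs => rw [hν]
      push_cast
      rw [map_mul, map_pow]
    have this2 : algebraMap (𝓞 L) L (D.inc (ε : 𝓞 D.K)) =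
        algebraMap (𝓞 L) L (D.inc (((ε : EQ D.K).out : (𝓞 D.K)ˣ) : 𝓞 D.K)) *
          algebraMap (𝓞 L) L (D.inc ν) ^ 2 := by
      rw [this, map_mul, map_pow]
    change algebraMap (𝓞 L) L _ * algebraMap (𝓞 L) L (D.inc (ε : 𝓞 D.K)) * g ^ 2 =
      algebraMap (𝓞 L) L _ * algebraMap (𝓞 L) L _ * (g * algebraMap (𝓞 L) L _) ^ 2
    rw [this2]
    ring

lemma lower_fun (D : Dat p L) : ∃ v : EQ L × (powMonoidHom 2 : ClassGroup (𝓞 L) →* _).ker → 𝓞 L,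
    (∀ t, Good (v t)) ∧ ∀ t t', ∀ g : L, g ≠ 0 → ((v t : 𝓞 L) : L) = (v t' : 𝓞 L) * g ^ 2 → t = t' := by
  classical
  have h1 : ∀ c : (powMonoidHom 2 : ClassGroup (𝓞 L) →* _).ker, ∃ (I : nonZeroDivisors (Ideal (𝓞 L)))
      (y : 𝓞 L), ClassGroup.mk0 I = c ∧ y ≠ 0 ∧ Ideal.span {y} = (I : Ideal (𝓞 L)) ^ 2 := by
    rintro ⟨c, hc⟩
    obtain ⟨I, hI⟩ := ClassGroup.mk0_surjective c
    rw [MonoidHom.mem_ker, powMonoidHom_apply, ← hI, ← map_pow] at hc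
    have h2 := (ClassGroup.mk0_eq_one_iff (I := (I : Ideal (𝓞 L)) ^ 2) (pow_mem I.2 2)).1 hc
    obtain ⟨y, hy⟩ := h2
    rw [Ideal.submodule_span_eq] at hy
    refine ⟨I, y, hI, ?_, hy.symm⟩
    rintro rfl
    rw [Ideal.span_singleton_zero] at hy
    exact pow_ne_zero 2 (nonZeroDivisors.coe_ne_zero I) hy
  choose I y hI hy0 hy using h1
  have hsp : ∀ t : EQ L × (powMonoidHom 2 : ClassGroup (𝓞 L) →* _).ker,
      Ideal.span {((t.1.out : (𝓞 L)ˣ) : 𝓞 L) * y t.2} = (I t.2 : Ideal (𝓞 L)) ^ 2 := by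
    intro t
    rw [← hy, Ideal.span_singleton_mul_left_unit (Units.isUnit _)]
  refine ⟨fun t => ((t.1.out : (𝓞 L)ˣ) : 𝓞 L) * y t.2, ?_, ?_⟩
  · intro t
    exact ⟨mul_ne_zero (Units.ne_zero _) (hy0 _), I t.2, hsp t⟩
  · intro t t' g hg e
    obtain ⟨b, n, hn, rfl⟩ := IsFractionRing.div_surjective (A := 𝓞 L) g
    have hn0 : n ≠ 0 := nonZeroDivisors.ne_zero hn
    have hn0' : algebraMap (𝓞 L) L n ≠ 0 := by simpa using hn0
    have hb0 : b ≠ 0 := by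
      rintro rfl; exact hg (by simp)
    have e3 : (((t.1.out : (𝓞 L)ˣ) : 𝓞 L) * y t.2) * n ^ 2 =
        (((t'.1.out : (𝓞 L)ˣ) : 𝓞 L) * y t'.2) * b ^ 2 := by
      apply RingOfIntegers.ext
      change algebraMap (𝓞 L) L _ = algebraMap (𝓞 L) L _
      rw [map_mul, map_mul _ _ (b ^ 2), map_pow, map_pow]
      refine (congrArg (· * (algebraMap (𝓞 L) L n) ^ 2) e).trans ?_
      change _ * _ * _ = _
      field_simp
    have e4 : (I t.2 : Ideal (𝓞 L)) * Ideal.span {n} = (I t'.2 : Ideal (𝓞 L)) * Ideal.span {b} := by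
      have : ((I t.2 : Ideal (𝓞 L)) * Ideal.span {n}) ^ 2 = ((I t'.2 : Ideal (𝓞 L)) * Ideal.span {b}) ^ 2 := by
        rw [mul_pow, mul_pow, ← hsp, ← hsp, Ideal.span_singleton_pow, Ideal.span_singleton_pow,
          Ideal.span_singleton_mul_span_singleton, Ideal.span_singleton_mul_span_singleton, e3]
      apply dvd_antisymm
      · exact (UniqueFactorizationMonoid.pow_dvd_pow_iff_dvd (n := 2) (by norm_num)).1 this.dvd
      · exact (UniqueFactorizationMonoid.pow_dvd_pow_iff_dvd (n := 2) (by norm_num)).1 this.symm.dvd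
    have hc : t.2 = t'.2 := by
      apply Subtype.ext
      rw [← hI, ← hI, ClassGroup.mk0_eq_mk0_iff]
      refine ⟨n, b, hn0, hb0, ?_⟩
      rw [mul_comm, e4, mul_comm]
    have hI0 : (I t'.2 : Ideal (𝓞 L)) ≠ 0 := nonZeroDivisors.coe_ne_zero _
    rw [hc] at e4 e3
    have e5 : Associated b n := Ideal.span_singleton_eq_span_singleton.1 (mul_left_cancel₀ hI0 e4).symm
    obtain ⟨w, rfl⟩ := e5
    have e6 : (t'.1.out : (𝓞 L)ˣ) = t.1.out * w ^ 2 := by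
      apply Units.ext
      push_cast
      refine mul_right_cancel₀ (mul_ne_zero (hy0 t'.2) (pow_ne_zero 2 hb0)) ?_
      linear_combination -e3
    have e7 := EQ_eq' e6
    rw [QuotientGroup.out_eq', QuotientGroup.out_eq'] at e7
    exact Prod.ext e7 hc

theorem ker_le (D : Dat p L) : Nat.card (powMonoidHom 2 : ClassGroup (𝓞 L) →* _).ker ≤ 2 := by
  classical
  obtain ⟨n, f, hnf⟩ := D.upper_fun
  obtain ⟨v, hv, hinj⟩ := D.lower_fun
  have hfin : Finite (EQ D.K) := Nat.finite_of_card_ne_zero (by rw [D.card_EK]; norm_num)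
  have hr : ∀ e : EQ D.K, ∃ r, (∃ t, n (v t) = e) → n (v r) = e := by
    intro e
    by_cases h : ∃ t, n (v t) = e
    · obtain ⟨t, ht⟩ := h
      exact ⟨t, fun _ => ht⟩
    · exact ⟨1, fun h' => absurd h' h⟩
  choose r hr using hr
  have hb : ∀ t, ∃ b, ∃ g : L, g ≠ 0 ∧ ((v t : 𝓞 L) : L) * (v (r (n (v t))) : 𝓞 L) = f b * g ^ 2 :=
    fun t => hnf _ _ (hv _) (hv _) (hr _ ⟨t, rfl⟩).symm
  choose b g hg hb using hb
  have key : Function.Injective (fun t => (n (v t), b t)) := by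
    intro t t' h
    simp only [Prod.mk.injEq] at h
    have h1 := hb t
    have h2 := hb t'
    rw [h.1, h.2] at h1
    have hr0 : ((v (r (n (v t'))) : 𝓞 L) : L) ≠ 0 := by simpa using (hv (r (n (v t')))).1
    refine hinj t t' (g t / g t') (div_ne_zero (hg _) (hg _)) ?_
    refine mul_right_cancel₀ hr0 ?_
    have := hg t'
    rw [h1]
    have e : ((v t' : 𝓞 L) : L) * (g t / g t') ^ 2 * (v (r (n (v t'))) : 𝓞 L) =
      (((v t' : 𝓞 L) : L) * (v (r (n (v t'))) : 𝓞 L)) * (g t / g t') ^ 2 := by ring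
    rw [e, h2]
    field_simp
  have hle := Nat.card_le_card_of_injective _ key
  rw [Nat.card_prod, Nat.card_prod, Nat.card_prod, D.card_EL, D.card_EK] at hle
  have : Nat.card Bool = 2 := by simp
  rw [this] at hle
  omega

end Dat

end

/-- Let `p ≡ 7 (mod 8)` be a prime. Then the 2-class group of `L_p = ℚ(ζ₈, √p)` is cyclic
and nontrivial. -/
theorem stmt_15 (p : ℕ) (hp : p.Prime) (hp8 : p % 8 = 7)
    (L : Type) [Field L] [NumberField L]
    (ζ : L) (hζ : IsPrimitiveRoot ζ 8) (s : L) (hs : s ^ 2 = (p : L))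
    (hgen : Algebra.adjoin ℚ {ζ, s} = ⊤) :
    ∀ P : Sylow 2 (ClassGroup (𝓞 L)), IsCyclic P ∧ Nontrivial P := by
  intro P
  obtain ⟨σ, τ, κ, h1, h2, h3, h4, h5⟩ := D_aut hp hp8 hζ hs hgen
  let D : Dat p L := ⟨hp, hp8, ζ, s, hζ, hs, hgen, σ, τ, κ, h1, h2, h3, h4, h5⟩
  exact ⟨A_sylow D.ker_le P, A_nontriv D.even_card P⟩
end
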